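/- Free entropy concentration with respect to the Gaussian disorder ψ₁ (Lemma G.3). Let ψ₁ = {X_μ^{(0)}, ζ_μ^{*(L)}, Z_μ}_{μ=1}^n. There exists a constant C(f,φ) (depending also on L and bounds on the ratios of the widths) such that, uniformly in t ∈ [0,1], E( (1/n) log Z_t − E_{ψ₁}[(1/n) log Z_t] )² ≤ C(f,φ)/n, where E_{ψ₁} denotes the conditional expectation over ψ₁ given all the other random parameters. -/

import Mathlib

open MeasureTheory ProbabilityTheory

noncomputable section

/-- Standard Gaussian measure on `ℝ`. -/
def stdG : Measure ℝ := gaussianReal 0 1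

instance : IsProbabilityMeasure stdG := by unfold stdG; infer_instance

/-- Standard Gaussian measure on `Fin k → ℝ`. -/
def stdGPi (k : ℕ) : Measure (Fin k → ℝ) := Measure.pi fun _ => stdG

instance (k : ℕ) : IsProbabilityMeasure (stdGPi k) := by unfold stdGPi; infer_instance

/-- The space of weights of an `L`-hidden-layer network with widths `d 0, …, d L`. -/
abbrev Wspace (d : ℕ → ℕ) (L : ℕ) :=
  (ℓ : Fin L) → Fin (d ((ℓ : ℕ) + 1)) → Fin (d (ℓ : ℕ)) → ℝ

/-- i.i.d. standard Gaussian measure on the weights. -/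
def Wmeasure (d : ℕ → ℕ) (L : ℕ) : Measure (Wspace d L) :=
  Measure.pi fun ℓ => Measure.pi fun _ => stdGPi (d (ℓ : ℕ))

instance (d : ℕ → ℕ) (L : ℕ) : IsProbabilityMeasure (Wmeasure d L) := by
  unfold Wmeasure; infer_instance

/-- Extension of a finite collection of weight matrices to all layer indices (by zero). -/
def extW {d : ℕ → ℕ} {L : ℕ} (W : Wspace d L) (ℓ : ℕ) : Fin (d (ℓ + 1)) → Fin (d ℓ) → ℝ :=
  if h : ℓ < L then W ⟨ℓ, h⟩ else 0

/-- Post-activations `X^{(ℓ)} = φ(W^{(ℓ)} X^{(ℓ-1)} / √d_{ℓ-1})`. -/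
def feat (φ : ℝ → ℝ) (d : ℕ → ℕ) (W : (ℓ : ℕ) → Fin (d (ℓ + 1)) → Fin (d ℓ) → ℝ)
    (x0 : Fin (d 0) → ℝ) : (ℓ : ℕ) → Fin (d ℓ) → ℝ
  | 0 => x0
  | (ℓ + 1) => fun i => φ ((∑ j, W ℓ i j * feat φ d W x0 ℓ j) / Real.sqrt (d ℓ : ℝ))

/-- Output kernel `P_out(y | x)`. -/
def Pout {p : ℕ} (PA : Measure (Fin p → ℝ)) (Δ : ℝ) (f : ℝ → (Fin p → ℝ) → ℝ)
    (y x : ℝ) : ℝ :=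
  ∫ A, Real.exp (-(y - f x A) ^ 2 / (2 * Δ)) / Real.sqrt (2 * Real.pi * Δ) ∂PA

/-- The channel smeared with the extra Gaussian noise `√ε ξ`. -/
def PoutEps {p : ℕ} (PA : Measure (Fin p → ℝ)) (Δ : ℝ) (f : ℝ → (Fin p → ℝ) → ℝ)
    (ε y s : ℝ) : ℝ :=
  ∫ ξ, Pout PA Δ f y (s + Real.sqrt ε * ξ) ∂stdG

/-- The coefficients `σ_ℓ`. -/
def sigmaC (φ : ℝ → ℝ) : ℕ → ℝ
  | 0 => 1
  | (ℓ + 1) => ∫ z, (φ (z * Real.sqrt (sigmaC φ ℓ))) ^ 2 ∂stdG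

/-- The coefficients `ρ_ℓ` (meaningful for `ℓ ≥ 1`). -/
def rhoC (φ : ℝ → ℝ) (ℓ : ℕ) : ℝ :=
  ∫ z, deriv φ (z * Real.sqrt (sigmaC φ (ℓ - 1))) ∂stdG

/-- The coefficients `ε_ℓ = σ_ℓ - σ_{ℓ-1} ρ_ℓ²` (meaningful for `ℓ ≥ 1`). -/
def epsC (φ : ℝ → ℝ) (ℓ : ℕ) : ℝ :=
  sigmaC φ ℓ - sigmaC φ (ℓ - 1) * (rhoC φ ℓ) ^ 2

/-- `d_m = min{d_0, …, d_L}`. -/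
def dmin (d : ℕ → ℕ) (L : ℕ) : ℕ :=
  (Finset.range (L + 1)).inf' (Finset.nonempty_range_iff.mpr (Nat.succ_ne_zero L)) d

/-- Linear readout of the `L`-layer network: `a⊤ X^{(L)} / √d_L`. -/
def netOut (φ : ℝ → ℝ) (d : ℕ → ℕ) (L : ℕ) (W : Wspace d L) (a : Fin (d L) → ℝ)
    (x0 : Fin (d 0) → ℝ) : ℝ :=
  (∑ i, a i * feat φ d (extW W) x0 L i) / Real.sqrt (d L : ℝ)

/-- Partition function (normalisation of the Bayes posterior) of the `L`-layer model. -/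
def partFun (L p : ℕ) (PA : Measure (Fin p → ℝ)) [IsProbabilityMeasure PA]
    (Δ ρ ε : ℝ) (φ : ℝ → ℝ) (f : ℝ → (Fin p → ℝ) → ℝ) (d : ℕ → ℕ) (n : ℕ)
    (X : Fin n → Fin (d 0) → ℝ) (Y : Fin n → ℝ) : ℝ :=
  ∫ θ : Wspace d L × (Fin (d L) → ℝ),
      ∏ μ, PoutEps PA Δ f ε (Y μ) (ρ * netOut φ d L θ.1 θ.2 (X μ))
    ∂((Wmeasure d L).prod (stdGPi (d L)))

/-- Space of all the quenched randomness of the `L`-layer teacher model: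
inputs, teacher weights, readout, output noises `ξ*`, label noises `Z` and channel
randomness `A`. -/
abbrev Dspace (d : ℕ → ℕ) (L p n : ℕ) :=
  (Fin n → Fin (d 0) → ℝ) × Wspace d L × (Fin (d L) → ℝ) ×
    (Fin n → ℝ) × (Fin n → ℝ) × (Fin n → Fin p → ℝ)

/-- Law of the quenched randomness. -/
def Dmeasure (d : ℕ → ℕ) (L p n : ℕ) (PA : Measure (Fin p → ℝ))
    [IsProbabilityMeasure PA] : Measure (Dspace d L p n) :=
  (Measure.pi fun _ : Fin n => stdGPi (d 0)).prod
    ((Wmeasure d L).prod ((stdGPi (d L)).prod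
      ((stdGPi n).prod ((stdGPi n).prod (Measure.pi fun _ : Fin n => PA)))))

/-- Teacher pre-readout signal `S_μ = ρ a*⊤X_μ^{(L)}/√d_L + √ε ξ*_μ`. -/
def Ssig (φ : ℝ → ℝ) (d : ℕ → ℕ) (L p n : ℕ) (ρ ε : ℝ) (ω : Dspace d L p n)
    (μi : Fin n) : ℝ :=
  ρ * netOut φ d L ω.2.1 ω.2.2.1 (ω.1 μi) + Real.sqrt ε * ω.2.2.2.1 μi

/-- Teacher responses `Y_μ = f(S_μ; A_μ) + √Δ Z_μ`. -/
def Yresp (φ : ℝ → ℝ) (f : ℝ → (Fin p → ℝ) → ℝ) (d : ℕ → ℕ) (L n : ℕ)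
    (ρ ε Δ : ℝ) (ω : Dspace d L p n) (μi : Fin n) : ℝ :=
  f (Ssig φ d L p n ρ ε ω μi) (ω.2.2.2.2.2 μi) + Real.sqrt Δ * ω.2.2.2.2.1 μi

/-- Mutual information per sample
`(1/n) I_n = E log P_out(Y_1|S_1) - (1/n) E log Z_L(D_L)`
(the first term is written as an average over samples, all equal by symmetry). -/
def MIper (L p : ℕ) (PA : Measure (Fin p → ℝ)) [IsProbabilityMeasure PA]
    (Δ ρ ε : ℝ) (φ : ℝ → ℝ) (f : ℝ → (Fin p → ℝ) → ℝ) (d : ℕ → ℕ) (n : ℕ) : ℝ :=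
  (1 / (n : ℝ)) * ∑ μi : Fin n,
      ∫ ω, Real.log (Pout PA Δ f (Yresp φ f d L n ρ ε Δ ω μi) (Ssig φ d L p n ρ ε ω μi))
        ∂(Dmeasure d L p n PA)
    - (1 / (n : ℝ)) *
      ∫ ω, Real.log (partFun L p PA Δ ρ ε φ f d n ω.1 (Yresp φ f d L n ρ ε Δ ω))
        ∂(Dmeasure d L p n PA)


/-- `u′_y(x) = ∂_x log P_out(y|x)`. -/
def uD1 {p : ℕ} (PA : Measure (Fin p → ℝ)) (Δ : ℝ) (f : ℝ → (Fin p → ℝ) → ℝ)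
    (y x : ℝ) : ℝ := deriv (fun x' => Real.log (Pout PA Δ f y x')) x

/-- First block of quenched randomness `ψ₁ = (X, ζ*, Z)`. -/
abbrev psi1Space (d : ℕ → ℕ) (n : ℕ) :=
  (Fin n → Fin (d 0) → ℝ) × (Fin n → ℝ) × (Fin n → ℝ)

def psi1Measure (d : ℕ → ℕ) (n : ℕ) : Measure (psi1Space d n) :=
  (Measure.pi fun _ : Fin n => stdGPi (d 0)).prod ((stdGPi n).prod (stdGPi n))

instance (d : ℕ → ℕ) (n : ℕ) : IsProbabilityMeasure (psi1Measure d n) := by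
  unfold psi1Measure; infer_instance

/-- Second block `ψ₂ = (A_μ)_μ`. -/
abbrev psi2Space (p n : ℕ) := Fin n → Fin p → ℝ

def psi2Measure (p n : ℕ) (PA : Measure (Fin p → ℝ)) [IsProbabilityMeasure PA] :
    Measure (psi2Space p n) := Measure.pi fun _ : Fin n => PA

instance (p n : ℕ) (PA : Measure (Fin p → ℝ)) [IsProbabilityMeasure PA] :
    IsProbabilityMeasure (psi2Measure p n PA) := by unfold psi2Measure; infer_instance

/-- Third block `ψ₃ = (W*, a*, v*)`. -/
abbrev psi3Space (d : ℕ → ℕ) (L : ℕ) :=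
  Wspace d L × (Fin (d L) → ℝ) × (Fin (d (L - 1)) → ℝ)

def psi3Measure (d : ℕ → ℕ) (L : ℕ) : Measure (psi3Space d L) :=
  (Wmeasure d L).prod ((stdGPi (d L)).prod (stdGPi (d (L - 1))))

instance (d : ℕ → ℕ) (L : ℕ) : IsProbabilityMeasure (psi3Measure d L) := by
  unfold psi3Measure; infer_instance

/-- Full quenched randomness of the interpolating model. -/
abbrev interpSpace (d : ℕ → ℕ) (L p n : ℕ) :=
  psi1Space d n × psi2Space p n × psi3Space d L

def interpMeasure (d : ℕ → ℕ) (L p n : ℕ) (PA : Measure (Fin p → ℝ))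
    [IsProbabilityMeasure PA] : Measure (interpSpace d L p n) :=
  (psi1Measure d n).prod ((psi2Measure p n PA).prod (psi3Measure d L))

/-- Interpolating signal
`√(1−t) a⊤φ(W^{(L)}X^{(L−1)}/√d_{L−1})/√d_L + √t ρ_L v⊤X^{(L−1)}/√d_{L−1} + √(tε_L) ζ`. -/
def interpSig (φ : ℝ → ℝ) (d : ℕ → ℕ) (L : ℕ) (t : ℝ) (W : Wspace d L)
    (a : Fin (d L) → ℝ) (v : Fin (d (L - 1)) → ℝ) (ζ : ℝ) (x0 : Fin (d 0) → ℝ) : ℝ :=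
  Real.sqrt (1 - t) * netOut φ d L W a x0 +
    Real.sqrt t * rhoC φ L *
      ((∑ j, v j * feat φ d (extW W) x0 (L - 1) j) / Real.sqrt (d (L - 1) : ℝ)) +
    Real.sqrt (t * epsC φ L) * ζ

/-- Teacher interpolating signal `S_{tμ}`. -/
def StI (φ : ℝ → ℝ) (d : ℕ → ℕ) (L p n : ℕ) (t : ℝ) (ω : interpSpace d L p n)
    (μi : Fin n) : ℝ :=
  interpSig φ d L t ω.2.2.1 ω.2.2.2.1 ω.2.2.2.2 (ω.1.2.1 μi) (ω.1.1 μi)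

/-- Interpolating responses `Y_{tμ} = f(S_{tμ};A_μ) + √Δ Z_μ`. -/
def YtI (φ : ℝ → ℝ) (f : ℝ → (Fin p → ℝ) → ℝ) (d : ℕ → ℕ) (L n : ℕ) (Δ t : ℝ)
    (ω : interpSpace d L p n) (μi : Fin n) : ℝ :=
  f (StI φ d L p n t ω μi) (ω.2.1 μi) + Real.sqrt Δ * ω.1.2.2 μi

/-- Student variables `(W, a, v, ζ)` of the interpolating model. -/
abbrev studSpace (d : ℕ → ℕ) (L n : ℕ) :=
  Wspace d L × (Fin (d L) → ℝ) × (Fin (d (L - 1)) → ℝ) × (Fin n → ℝ)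

def studMeasure (d : ℕ → ℕ) (L n : ℕ) : Measure (studSpace d L n) :=
  (Wmeasure d L).prod ((stdGPi (d L)).prod ((stdGPi (d (L - 1))).prod (stdGPi n)))

instance (d : ℕ → ℕ) (L n : ℕ) : IsProbabilityMeasure (studMeasure d L n) := by
  unfold studMeasure; infer_instance

/-- Student replica `s_{tμ}`. -/
def stI (φ : ℝ → ℝ) (d : ℕ → ℕ) (L n : ℕ) (t : ℝ) (X : Fin n → Fin (d 0) → ℝ)
    (τ : studSpace d L n) (μi : Fin n) : ℝ :=
  interpSig φ d L t τ.1 τ.2.1 τ.2.2.1 (τ.2.2.2 μi) (X μi)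

/-- Interpolating partition function `Z_t`. -/
def ZtI (L p : ℕ) (PA : Measure (Fin p → ℝ)) [IsProbabilityMeasure PA] (Δ : ℝ)
    (φ : ℝ → ℝ) (f : ℝ → (Fin p → ℝ) → ℝ) (d : ℕ → ℕ) (n : ℕ) (t : ℝ)
    (ω : interpSpace d L p n) : ℝ :=
  ∫ τ, ∏ μi, Pout PA Δ f (YtI φ f d L n Δ t ω μi) (stI φ d L n t ω.1.1 τ μi)
    ∂(studMeasure d L n)


open scoped ENNReal

lemma map_sum_mul_stdGPi {k : ℕ} (u : Fin k → ℝ) :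
    (stdGPi k).map (fun a => ∑ j, a j * u j) =
      stdG.map (fun z => Real.sqrt (∑ j, u j ^ 2) * z) := by
  have hlaw : ∀ j : Fin k, HasLaw (fun a : Fin k → ℝ => a j) (gaussianReal 0 1) (stdGPi k) :=
    fun j => (measurePreserving_eval (fun _ : Fin k => stdG) j).hasLaw
  have hind : iIndepFun (fun (j : Fin k) (a : Fin k → ℝ) => a j) (stdGPi k) :=
    iIndepFun_pi (μ := fun _ : Fin k => stdG) (X := fun _ x => x) (fun _ => aemeasurable_id)
  have hind' : iIndepFun (fun (j : Fin k) (a : Fin k → ℝ) => a j * u j) (stdGPi k) :=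
    hind.comp (fun j x => x * u j) (fun j => by fun_prop)
  have hg : ∀ j, HasGaussianLaw (fun a : Fin k → ℝ => a j * u j) (stdGPi k) := fun j =>
    (gaussianReal_mul_const (hlaw j) (u j)).hasGaussianLaw
  have hs : HasGaussianLaw (fun a : Fin k → ℝ => ∑ j, a j * u j) (stdGPi k) :=
    hind'.hasGaussianLaw_fun_sum hg
  rw [hs.map_eq_gaussianReal, stdG, gaussianReal_map_const_mul]
  have hmean : ∫ a, ∑ j, a j * u j ∂(stdGPi k) = 0 := by
    rw [integral_finsetSum _ (fun j _ => (hg j).integrable)]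
    refine Finset.sum_eq_zero fun j _ => ?_
    rw [integral_mul_const, (hlaw j).integral_eq]
    simp
  have hvar : Var[fun a => ∑ j, a j * u j; stdGPi k] = ∑ j, u j ^ 2 := by
    have := IndepFun.variance_sum (s := Finset.univ)
      (X := fun (j : Fin k) (a : Fin k → ℝ) => a j * u j)
      (fun j _ => (hg j).memLp_two) (fun i _ j _ hij => hind'.indepFun hij)
    rw [show (∑ i : Fin k, fun a : Fin k → ℝ => a i * u i) = fun a => ∑ j, a j * u j by
      ext; simp] at this
    rw [this]
    refine Finset.sum_congr rfl fun j _ => ?_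
    rw [variance_mul_const, (hlaw j).variance_eq]
    simp
  congr 1
  · simp [hmean]
  · rw [hvar]; ext
    simp [Real.sq_sqrt (Finset.sum_nonneg fun j _ => sq_nonneg (u j)),
      Finset.sum_nonneg fun j _ => sq_nonneg (u j)]

/-- The fourth moment of the standard Gaussian measure. -/
def gaussFourth : ℝ≥0∞ := ∫⁻ z, ENNReal.ofReal (z ^ 4) ∂stdG

lemma gaussFourth_lt_top : gaussFourth < ∞ := by
  have h : MemLp id 4 stdG := memLp_id_gaussianReal 4
  have := h.integrable_norm_pow (p := 4) (by norm_num)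
  simp only [id, Real.norm_eq_abs] at this
  have h2 := this.lintegral_lt_top
  refine lt_of_le_of_lt (lintegral_mono fun z => ?_) h2
  exact ENNReal.ofReal_le_ofReal (by rw [← abs_pow]; exact le_abs_self _)

lemma lintegral_linear_pow_four {k : ℕ} (u : Fin k → ℝ) :
    ∫⁻ a, ENNReal.ofReal (((∑ j, a j * u j) / Real.sqrt k) ^ 4) ∂(stdGPi k)
      ≤ gaussFourth * ((∑ j, ENNReal.ofReal (u j ^ 4)) / k) := by
  rcases Nat.eq_zero_or_pos k with rfl | hk
  · simp
  have hk' : (0 : ℝ) < k := by exact_mod_cast hk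
  have h1 : ∫⁻ a, ENNReal.ofReal (((∑ j, a j * u j) / Real.sqrt k) ^ 4) ∂(stdGPi k)
      = ∫⁻ s, ENNReal.ofReal ((s / Real.sqrt k) ^ 4)
        ∂((stdGPi k).map (fun a => ∑ j, a j * u j)) := by
    rw [lintegral_map (by fun_prop) (by fun_prop)]
  rw [h1, map_sum_mul_stdGPi, lintegral_map (by fun_prop) (by fun_prop)]
  have h2 : ∀ z : ℝ, ENNReal.ofReal ((Real.sqrt (∑ j, u j ^ 2) * z / Real.sqrt k) ^ 4)
      = ENNReal.ofReal (((∑ j, u j ^ 2) / k) ^ 2) * ENNReal.ofReal (z ^ 4) := fun z => by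
    rw [← ENNReal.ofReal_mul (by positivity)]
    congr 1
    have e1 : Real.sqrt (∑ j, u j ^ 2) ^ 4 = (∑ j, u j ^ 2) ^ 2 := by
      rw [show 4 = 2 * 2 by norm_num, pow_mul,
        Real.sq_sqrt (Finset.sum_nonneg fun j _ => sq_nonneg _)]
    have e2 : Real.sqrt (k : ℝ) ^ 4 = (k : ℝ) ^ 2 := by
      rw [show 4 = 2 * 2 by norm_num, pow_mul, Real.sq_sqrt hk'.le]
    rw [div_pow, mul_pow, e1, e2]; ring
  simp_rw [h2]
  rw [lintegral_const_mul _ (by fun_prop), mul_comm]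
  change gaussFourth * _ ≤ _
  gcongr
  rw [← ENNReal.ofReal_sum_of_nonneg (fun j _ => by positivity),
    ← ENNReal.ofReal_natCast, ← ENNReal.ofReal_div_of_pos hk']
  apply ENNReal.ofReal_le_ofReal
  have := sq_sum_le_card_mul_sum_sq (s := Finset.univ) (f := fun j : Fin k => u j ^ 2)
  simp only [Finset.card_univ, Fintype.card_fin, ← pow_mul] at this
  rw [div_pow, div_le_div_iff₀ (by positivity) hk']
  calc _ ≤ (k * ∑ j, u j ^ (2 * 2)) * (k : ℝ) := by gcongr
    _ = _ := by norm_num; ring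

/-- Resampling one coordinate preserves a product measure. -/
lemma measurePreserving_update {ι : Type*} [Fintype ι] [DecidableEq ι] {α : ι → Type*}
    [∀ i, MeasurableSpace (α i)] (μ : ∀ i, Measure (α i)) [∀ i, IsProbabilityMeasure (μ i)]
    (i : ι) :
    MeasurePreserving (fun q : (∀ i, α i) × α i => Function.update q.1 i q.2)
      ((Measure.pi μ).prod (μ i)) (Measure.pi μ) := by
  have hm : Measurable (fun q : (∀ i, α i) × α i => Function.update q.1 i q.2) := by
    exact measurable_update'
  refine ⟨hm, (Measure.pi_eq fun s hs => ?_).symm⟩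
  rw [Measure.map_apply hm (MeasurableSet.univ_pi hs)]
  have : (fun q : (∀ i, α i) × α i => Function.update q.1 i q.2) ⁻¹' (Set.univ.pi s)
      = (Set.univ.pi (Function.update s i Set.univ)) ×ˢ s i := by
    ext ⟨x, y⟩
    simp only [Set.mem_preimage, Set.mem_pi, Set.mem_univ, true_imp_iff, Set.mem_prod]
    constructor
    · intro h
      refine ⟨fun j => ?_, by simpa using h i⟩
      by_cases hj : j = i
      · subst hj; simp
      · simpa [hj] using h j
    · rintro ⟨h, hy⟩ j
      by_cases hj : j = i
      · subst hj; simpa using hy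
      · simpa [hj] using h j
  rw [this, Measure.prod_prod, Measure.pi_pi, ← Finset.mul_prod_erase _ _ (Finset.mem_univ i),
    ← Finset.mul_prod_erase _ (fun j => μ j (s j)) (Finset.mem_univ i)]
  simp only [Function.update_self, measure_univ, one_mul]
  rw [mul_comm]
  congr 1
  refine Finset.prod_congr rfl fun j hj => ?_
  rw [Function.update_of_ne (Finset.ne_of_mem_erase hj)]

lemma integrable_of_measurable_bounded {α : Type*} [MeasurableSpace α] {μ : Measure α}
    [IsFiniteMeasure μ] {h : α → ℝ} {M : ℝ} (hm : Measurable h) (hb : ∀ x, |h x| ≤ M) :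
    Integrable h μ :=
  Integrable.of_bound hm.aestronglyMeasurable M (Filter.Eventually.of_forall hb)

lemma sq_integral_le_integral_sq {α : Type*} [MeasurableSpace α] {μ : Measure α}
    [IsProbabilityMeasure μ] {h : α → ℝ} (h1 : MemLp h 2 μ) :
    (∫ x, h x ∂μ) ^ 2 ≤ ∫ x, h x ^ 2 ∂μ := by
  have := variance_nonneg h μ
  rw [variance_eq_sub h1] at this
  simpa using this

lemma integral_sq_sub_const {α : Type*} [MeasurableSpace α] {μ : Measure α}
    [IsProbabilityMeasure μ] {h : α → ℝ} (h1 : MemLp h 2 μ) (c : ℝ) :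
    ∫ x, (h x - c) ^ 2 ∂μ = ∫ x, h x ^ 2 ∂μ - 2 * c * ∫ x, h x ∂μ + c ^ 2 := by
  have hi := h1.integrable_sq
  have hi1 := h1.integrable one_le_two
  have : ∀ x, (h x - c) ^ 2 = h x ^ 2 - 2 * c * h x + c ^ 2 := fun x => by ring
  simp_rw [this]
  rw [integral_add (f := fun x => h x ^ 2 - 2 * c * h x) (hi.sub (hi1.const_mul _))
    (integrable_const _), integral_sub hi (hi1.const_mul _), integral_const_mul]
  simp

lemma integral_sq_sub_le_two_block {α β : Type*} [MeasurableSpace α] [MeasurableSpace β]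
    {ν : Measure α} {π : Measure β} [IsProbabilityMeasure ν] [IsProbabilityMeasure π]
    {H : α × β → ℝ} {g : β → ℝ} {M : ℝ} (hH : Measurable H) (hHb : ∀ q, |H q| ≤ M)
    (hg : Measurable g) (hgb : ∀ y, |g y| ≤ M) (m : ℝ) :
    ∫ q, (H q - m) ^ 2 ∂(ν.prod π) ≤
      ∫ q, (H q - g q.2) ^ 2 ∂(ν.prod π) + ∫ y, (∫ x, H (x, y) ∂ν - m) ^ 2 ∂π := by
  have hM : 0 ≤ M := by
    obtain ⟨x⟩ : Nonempty (α × β) := (ν.prod π).nonempty_of_neZero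
    exact (abs_nonneg _).trans (hHb x)
  have hmean : Measurable fun y => ∫ x, H (x, y) ∂ν :=
    (hH.stronglyMeasurable.integral_prod_left' (μ := ν)).measurable
  have hmeanb : ∀ y, |∫ x, H (x, y) ∂ν| ≤ M := fun y => by
    have := norm_integral_le_of_norm_le_const (μ := ν) (f := fun x => H (x, y)) (C := M)
      (Filter.Eventually.of_forall fun x => hHb _)
    simpa using this
  have sqb : ∀ a b : ℝ, |a| ≤ M → |b| ≤ M + |m| → |(a - b) ^ 2| ≤ (M + (M + |m|)) ^ 2 := by
    intro a b ha hb
    rw [abs_pow]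
    gcongr
    exact (abs_sub _ _).trans (add_le_add ha hb)
  have hM' : M ≤ M + |m| := le_add_of_nonneg_right (abs_nonneg m)
  have hm' : |m| ≤ M + |m| := le_add_of_nonneg_left hM
  have i1 : Integrable (fun q => (H q - m) ^ 2) (ν.prod π) :=
    integrable_of_measurable_bounded (by fun_prop) fun q => sqb _ _ (hHb q) hm'
  have i2 : Integrable (fun q => (H q - g q.2) ^ 2) (ν.prod π) :=
    integrable_of_measurable_bounded (by fun_prop) fun q => sqb _ _ (hHb q) ((hgb _).trans hM')
  have i3 : Integrable (fun y => (∫ x, H (x, y) ∂ν - m) ^ 2) π :=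
    integrable_of_measurable_bounded (by fun_prop) fun q => sqb _ _ (hmeanb q) hm'
  rw [integral_prod_symm _ i1, integral_prod_symm _ i2, ← integral_add i2.integral_prod_right i3]
  refine integral_mono i1.integral_prod_right (i2.integral_prod_right.add i3) fun y => ?_
  have hLp : MemLp (fun x => H (x, y)) 2 ν :=
    MemLp.of_bound (hH.comp measurable_prodMk_right).aestronglyMeasurable M
      (Filter.Eventually.of_forall fun x => hHb _)
  simp only
  rw [integral_sq_sub_const hLp, integral_sq_sub_const hLp]
  nlinarith [sq_nonneg ((∫ x, H (x, y) ∂ν) - g y)]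

lemma measurePreserving_finCons {Ω : Type*} [MeasurableSpace Ω] (ν : Measure Ω) [SigmaFinite ν]
    (n : ℕ) : MeasurePreserving (fun q : Ω × (Fin n → Ω) => (Fin.cons q.1 q.2 : Fin (n + 1) → Ω))
      (ν.prod (Measure.pi fun _ => ν)) (Measure.pi fun _ => ν) := by
  have h := (measurePreserving_piFinSuccAbove (fun _ : Fin (n + 1) => ν) 0).symm
  convert h using 1
  ext q i
  simp [MeasurableEquiv.piFinSuccAbove, Fin.insertNthEquiv]

/-- The Efron–Stein inequality for bounded functions. -/
lemma efronStein_of_bounded {Ω : Type*} [MeasurableSpace Ω] (ν : Measure Ω)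
    [IsProbabilityMeasure ν] (M : ℝ) :
    ∀ (n : ℕ) (F : (Fin n → Ω) → ℝ) (G : Fin n → (Fin n → Ω) → ℝ),
    Measurable F → (∀ x, |F x| ≤ M) → (∀ i, Measurable (G i)) → (∀ i x, |G i x| ≤ M) →
    (∀ i x y, G i (Function.update x i y) = G i x) →
    ∫ x, (F x - ∫ x', F x' ∂(Measure.pi fun _ => ν)) ^ 2 ∂(Measure.pi fun _ => ν) ≤
      ∑ i, ∫ x, (F x - G i x) ^ 2 ∂(Measure.pi fun _ => ν) := by
  intro n
  induction n with
  | zero =>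
    intro F G hF hFb hG hGb hGi
    have hF0 : ∀ x, F x = F default := fun x => by rw [Subsingleton.elim x default]
    simp_rw [hF0]
    simp
  | succ n ih =>
    intro F G hF hFb hG hGb hGi
    have hM : 0 ≤ M := by
      obtain ⟨x⟩ : Nonempty Ω := ν.nonempty_of_neZero
      exact (abs_nonneg _).trans (hFb fun _ => x)
    have hc := measurePreserving_finCons ν n
    have hcongr : ∀ f : (Fin (n + 1) → Ω) → ℝ, Measurable f → ∫ x, f x ∂(Measure.pi fun _ => ν)
        = ∫ q : Ω × (Fin n → Ω), f (Fin.cons q.1 q.2) ∂(ν.prod (Measure.pi fun _ => ν)) := by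
      intro f hf
      rw [← hc.map_eq, integral_map hc.measurable.aemeasurable hf.aestronglyMeasurable]
    obtain ⟨x0⟩ : Nonempty Ω := ν.nonempty_of_neZero
    set m := ∫ x', F x' ∂(Measure.pi fun _ => ν) with hm
    have hcm := hc.measurable
    have hmeas : ∀ f : (Fin (n + 1) → Ω) → ℝ, Measurable f →
        Measurable fun y : Fin n → Ω => ∫ x, f (Fin.cons x y) ∂ν := fun f hf =>
      ((hf.comp hcm).stronglyMeasurable.integral_prod_left' (μ := ν)).measurable
    have hbd : ∀ f : (Fin (n + 1) → Ω) → ℝ, (∀ x, |f x| ≤ M) →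
        ∀ y : Fin n → Ω, |∫ x, f (Fin.cons x y) ∂ν| ≤ M := fun f hf y => by
      have := norm_integral_le_of_norm_le_const (μ := ν) (f := fun x => f (Fin.cons x y)) (C := M)
        (Filter.Eventually.of_forall fun x => hf _)
      simpa using this
    have sl : ∀ (f : (Fin (n + 1) → Ω) → ℝ) (_ : Measurable f) (y : Fin n → Ω),
        Measurable fun x : Ω => f (Fin.cons x y) := fun f hf y =>
      (hf.comp hcm).comp measurable_prodMk_right
    have hintF : Integrable (fun q : Ω × (Fin n → Ω) => F (Fin.cons q.1 q.2))
        (ν.prod (Measure.pi fun _ => ν)) :=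
      integrable_of_measurable_bounded (hF.comp hcm) fun q => hFb _
    have key := integral_sq_sub_le_two_block (ν := ν) (π := Measure.pi fun _ : Fin n => ν)
      (H := fun q => F (Fin.cons q.1 q.2)) (g := fun y => G 0 (Fin.cons x0 y)) (M := M)
      (hF.comp hcm) (fun q => hFb _) (((hG 0).comp hcm).comp measurable_prodMk_left)
      (fun y => hGb _ _) m
    rw [hcongr _ (by fun_prop)]
    refine key.trans ?_
    rw [Fin.sum_univ_succ]
    refine add_le_add (le_of_eq ?_) ?_
    · rw [hcongr _ (by have := hG 0; fun_prop)]
      refine integral_congr_ae (Filter.Eventually.of_forall fun q => ?_)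
      have := hGi 0 (Fin.cons x0 q.2) q.1
      rw [Fin.update_cons_zero] at this
      simp only [this]
    · have hmm : m = ∫ y, ∫ x, F (Fin.cons x y) ∂ν ∂(Measure.pi fun _ : Fin n => ν) := by
        rw [hm, hcongr _ hF, integral_prod_symm _ hintF]
      have := ih (fun y => ∫ x, F (Fin.cons x y) ∂ν) (fun i y => ∫ x, G i.succ (Fin.cons x y) ∂ν)
        (hmeas F hF) (hbd F hFb) (fun i => hmeas _ (hG _)) (fun i => hbd _ (hGb _)) (fun i y z => by
          refine integral_congr_ae (Filter.Eventually.of_forall fun x => ?_)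
          have := hGi i.succ (Fin.cons x y) z
          rw [← Fin.cons_update] at this
          exact this)
      rw [← hmm] at this
      refine this.trans (Finset.sum_le_sum fun i _ => ?_)
      have hGi' := hG i.succ
      rw [hcongr _ (by fun_prop)]
      have sqb : ∀ q, |(F q - G i.succ q) ^ 2| ≤ (M + M) ^ 2 := fun q => by
        rw [abs_pow]
        gcongr
        exact (abs_sub _ _).trans (add_le_add (hFb _) (hGb _ _))
      have i2 : Integrable (fun q : Ω × (Fin n → Ω) =>
          (F (Fin.cons q.1 q.2) - G i.succ (Fin.cons q.1 q.2)) ^ 2)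
          (ν.prod (Measure.pi fun _ => ν)) :=
        integrable_of_measurable_bounded (((hF.sub hGi').comp hcm).pow_const 2) fun q => sqb _
      rw [integral_prod_symm _ i2]
      have b1 := hmeas F hF
      have b2 := hmeas _ hGi'
      refine integral_mono (integrable_of_measurable_bounded (M := (M + M) ^ 2) (by fun_prop)
        fun y => ?_) i2.integral_prod_right fun y => ?_
      · rw [abs_pow]
        gcongr
        exact (abs_sub _ _).trans (add_le_add (hbd F hFb _) (hbd _ (hGb _) _))
      · simp only
        rw [← integral_sub (integrable_of_measurable_bounded (sl F hF y) fun x => hFb _)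
          (integrable_of_measurable_bounded (sl _ hGi' y) fun x => hGb _ _)]
        refine sq_integral_le_integral_sq (MemLp.of_bound (C := M + M)
          ((sl F hF y).sub (sl _ hGi' y)).aestronglyMeasurable
          (Filter.Eventually.of_forall fun x => ?_))
        exact (abs_sub _ _).trans (add_le_add (hFb _) (hGb _ _))

/-- The Efron–Stein inequality. -/
lemma efronStein {Ω : Type*} [MeasurableSpace Ω] (ν : Measure Ω)
    [IsProbabilityMeasure ν] {n : ℕ} {F : (Fin n → Ω) → ℝ} {G : Fin n → (Fin n → Ω) → ℝ}
    (hF : Measurable F) (hF2 : MemLp F 2 (Measure.pi fun _ => ν)) (hG : ∀ i, Measurable (G i))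
    (hGi : ∀ i x y, G i (Function.update x i y) = G i x) :
    ∫⁻ x, ENNReal.ofReal ((F x - ∫ x', F x' ∂(Measure.pi fun _ => ν)) ^ 2)
        ∂(Measure.pi fun _ => ν) ≤
      ∑ i, ∫⁻ x, ENNReal.ofReal ((F x - G i x) ^ 2) ∂(Measure.pi fun _ => ν) := by
  set P : Measure (Fin n → Ω) := Measure.pi fun _ => ν with hP
  let c : ℕ → ℝ → ℝ := fun M x => max (-M) (min M x)
  have hcm : ∀ M, Measurable (c M) := fun M => by fun_prop
  have hcb : ∀ M x, |c M x| ≤ M := fun M x => by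
    have : (0 : ℝ) ≤ M := M.cast_nonneg
    exact abs_le.2 ⟨le_max_left _ _, max_le (by linarith) (min_le_left _ _)⟩
  have hcl : ∀ M a b, |c M a - c M b| ≤ |a - b| := fun M a b =>
    (abs_max_sub_max_le_max _ _ _ _).trans
      (by simpa using abs_min_sub_min_le_max (M : ℝ) a (M : ℝ) b)
  have hc0 : ∀ M, c M 0 = 0 := fun M => by simp [c]
  have hcabs : ∀ M a, |c M a| ≤ |a| := fun M a => by simpa [hc0] using hcl M a 0
  have hct : ∀ a, Filter.Tendsto (fun M => c M a) Filter.atTop (nhds a) := fun a => by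
    obtain ⟨N, hN⟩ := exists_nat_ge |a|
    refine tendsto_const_nhds.congr' ?_
    filter_upwards [Filter.eventually_ge_atTop N] with M hM
    have h1 : |a| ≤ (M : ℝ) := hN.trans (by exact_mod_cast hM)
    have h2 := abs_le.1 h1
    simp only [c]
    rw [min_eq_right h2.2, max_eq_right h2.1]
  have hF1 : Integrable F P := hF2.integrable one_le_two
  have hLp : ∀ M, MemLp (fun x => c M (F x)) 2 P := fun M =>
    MemLp.of_bound ((hcm M).comp hF).aestronglyMeasurable M
      (Filter.Eventually.of_forall fun x => hcb M _)
  have hb : ∀ M, ENNReal.ofReal (∫ x, (c M (F x) - ∫ x', c M (F x') ∂P) ^ 2 ∂P) ≤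
      ∑ i, ∫⁻ x, ENNReal.ofReal ((F x - G i x) ^ 2) ∂P := fun M => by
    have h := efronStein_of_bounded ν M n (fun x => c M (F x)) (fun i x => c M (G i x))
      ((hcm M).comp hF) (fun x => hcb M _) (fun i => (hcm M).comp (hG i)) (fun i x => hcb M _)
      (fun i x y => by rw [hGi])
    refine (ENNReal.ofReal_le_ofReal h).trans ?_
    rw [ENNReal.ofReal_sum_of_nonneg fun i _ => integral_nonneg fun x => sq_nonneg _]
    refine Finset.sum_le_sum fun i _ => ?_
    rw [ofReal_integral_eq_lintegral_ofReal _ (Filter.Eventually.of_forall fun x => sq_nonneg _)]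
    · refine lintegral_mono fun x => ENNReal.ofReal_le_ofReal ?_
      exact sq_le_sq.2 (hcl M _ _)
    · have := hG i
      refine integrable_of_measurable_bounded (M := ((M : ℝ) + M) ^ 2) (by fun_prop) fun x => ?_
      rw [abs_pow]
      gcongr
      exact (abs_sub _ _).trans (add_le_add (hcb _ _) (hcb _ _))
  have ht1 : Filter.Tendsto (fun M => ∫ x, c M (F x) ∂P) Filter.atTop (nhds (∫ x, F x ∂P)) := by
    refine tendsto_integral_of_dominated_convergence (fun x => |F x|)
      (fun M => ((hcm M).comp hF).aestronglyMeasurable) hF1.abs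
      (fun M => Filter.Eventually.of_forall fun x => hcabs M _)
      (Filter.Eventually.of_forall fun x => hct _)
  have ht2 : Filter.Tendsto (fun M => ∫ x, c M (F x) ^ 2 ∂P) Filter.atTop
      (nhds (∫ x, F x ^ 2 ∂P)) := by
    refine tendsto_integral_of_dominated_convergence (fun x => F x ^ 2)
      (fun M => (((hcm M).comp hF).pow_const 2).aestronglyMeasurable) hF2.integrable_sq
      (fun M => Filter.Eventually.of_forall fun x => ?_)
      (Filter.Eventually.of_forall fun x => (hct _).pow 2)
    rw [Real.norm_eq_abs, abs_of_nonneg (sq_nonneg _)]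
    exact sq_le_sq.2 (hcabs M _)
  have ht : Filter.Tendsto (fun M => ∫ x, (c M (F x) - ∫ x', c M (F x') ∂P) ^ 2 ∂P) Filter.atTop
      (nhds (∫ x, (F x - ∫ x', F x' ∂P) ^ 2 ∂P)) := by
    simp_rw [fun M => integral_sq_sub_const (hLp M) (∫ x', c M (F x') ∂P)]
    rw [integral_sq_sub_const hF2]
    exact ((ht2.sub ((ht1.const_mul 2).mul ht1)).add (ht1.pow 2))
  have hi : Integrable (fun x => (F x - ∫ x', F x' ∂P) ^ 2) P :=
    (hF2.sub (memLp_const _)).integrable_sq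
  rw [← ofReal_integral_eq_lintegral_ofReal hi (Filter.Eventually.of_forall fun x => sq_nonneg _)]
  exact le_of_tendsto' ((ENNReal.continuous_ofReal.tendsto _).comp ht) hb

lemma lintegral_pi_prod {Ω : Type*} [MeasurableSpace Ω] (ν : Measure Ω) [SigmaFinite ν] :
    ∀ (n : ℕ) (g : Fin n → Ω → ℝ≥0∞), (∀ i, Measurable (g i)) →
      ∫⁻ y, ∏ i, g i (y i) ∂(Measure.pi fun _ => ν) = ∏ i, ∫⁻ x, g i x ∂ν := by
  intro n
  induction n with
  | zero => intro g hg; simp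
  | succ n ih =>
    intro g hg
    have hc := measurePreserving_finCons ν n
    have hm : Measurable fun y : Fin n → Ω => ∏ i, g i.succ (y i) :=
      Finset.measurable_prod _ fun i _ => (hg i.succ).comp (measurable_pi_apply i)
    have hm' : Measurable fun y : Fin (n + 1) → Ω => ∏ i, g i (y i) :=
      Finset.measurable_prod _ fun i _ => (hg i).comp (measurable_pi_apply i)
    rw [← hc.lintegral_comp hm']
    simp only [Fin.prod_univ_succ, Fin.cons_zero, Fin.cons_succ]
    rw [lintegral_prod_mul (hg 0).aemeasurable hm.aemeasurable, ih _ fun i => hg i.succ]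

lemma pi_withDensity {Ω : Type*} [MeasurableSpace Ω] (ν : Measure Ω) [SigmaFinite ν] {n : ℕ}
    (g : Fin n → Ω → ℝ≥0∞) (hg : ∀ i, Measurable (g i))
    [∀ i, SigmaFinite (ν.withDensity (g i))] :
    Measure.pi (fun i => ν.withDensity (g i)) =
      (Measure.pi fun _ => ν).withDensity fun y => ∏ i, g i (y i) := by
  refine Measure.pi_eq fun s hs => ?_
  rw [withDensity_apply _ (MeasurableSet.univ_pi hs),
    ← lintegral_indicator (MeasurableSet.univ_pi hs)]
  simp_rw [withDensity_apply _ (hs _), ← lintegral_indicator (hs _)]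
  rw [← lintegral_pi_prod ν n (fun i => (s i).indicator (g i)) fun i => (hg i).indicator (hs i)]
  refine lintegral_congr fun y => ?_
  by_cases hy : y ∈ Set.univ.pi s
  · rw [Set.indicator_of_mem hy]
    exact Finset.prod_congr rfl fun i _ => (Set.indicator_of_mem (hy i trivial) _).symm
  · rw [Set.indicator_of_notMem hy]
    obtain ⟨i, hi⟩ : ∃ i, y i ∉ s i := by simpa [Set.mem_pi] using hy
    exact (Finset.prod_eq_zero (Finset.mem_univ i) (Set.indicator_of_notMem hi _)).symm

section Channel

variable {p : ℕ} (PA : Measure (Fin p → ℝ)) [IsProbabilityMeasure PA] {Δ : ℝ}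
  {f : ℝ → (Fin p → ℝ) → ℝ}

lemma measurable_Pout (hf : Measurable (Function.uncurry f)) :
    Measurable fun q : ℝ × ℝ => Pout PA Δ f q.1 q.2 := by
  have hf' : Measurable fun q : (ℝ × ℝ) × (Fin p → ℝ) => f q.1.2 q.2 :=
    hf.comp (by fun_prop : Measurable fun q : (ℝ × ℝ) × (Fin p → ℝ) => (q.1.2, q.2))
  have : Measurable fun q : (ℝ × ℝ) × (Fin p → ℝ) =>
      Real.exp (-(q.1.1 - f q.1.2 q.2) ^ 2 / (2 * Δ)) / Real.sqrt (2 * Real.pi * Δ) := by fun_prop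
  exact (this.stronglyMeasurable.integral_prod_right' (ν := PA)).measurable

lemma measurable_channel_arg (hf : Measurable (Function.uncurry f)) (s : ℝ) :
    Measurable fun A => f s A := hf.comp measurable_prodMk_left

lemma integrable_Pout_integrand (hΔ : 0 < Δ) (hf : Measurable (Function.uncurry f)) (y s : ℝ) :
    Integrable (fun A => Real.exp (-(y - f s A) ^ 2 / (2 * Δ)) / Real.sqrt (2 * Real.pi * Δ))
      PA := by
  have := measurable_channel_arg hf s
  refine integrable_of_measurable_bounded (M := 1 / Real.sqrt (2 * Real.pi * Δ)) (by fun_prop)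
    fun A => ?_
  rw [abs_of_nonneg (by positivity)]
  gcongr
  rw [Real.exp_le_one_iff]
  exact div_nonpos_of_nonpos_of_nonneg (by nlinarith [sq_nonneg (y - f s A)]) (by positivity)

lemma Pout_pos (hΔ : 0 < Δ) (hf : Measurable (Function.uncurry f)) (y s : ℝ) :
    0 < Pout PA Δ f y s := by
  have hpos : ∀ A, 0 < Real.exp (-(y - f s A) ^ 2 / (2 * Δ)) / Real.sqrt (2 * Real.pi * Δ) :=
    fun A => by positivity
  rw [Pout, integral_pos_iff_support_of_nonneg (fun A => (hpos A).le)
    (integrable_Pout_integrand PA hΔ hf y s)]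
  have : (Function.support fun A =>
      Real.exp (-(y - f s A) ^ 2 / (2 * Δ)) / Real.sqrt (2 * Real.pi * Δ)) = Set.univ :=
    Set.eq_univ_of_forall fun A => (hpos A).ne'
  simp [this]

lemma Pout_le (hΔ : 0 < Δ) (hf : Measurable (Function.uncurry f)) (y s : ℝ) :
    Pout PA Δ f y s ≤ 1 / Real.sqrt (2 * Real.pi * Δ) := by
  have := integral_mono (integrable_Pout_integrand PA hΔ hf y s)
    (integrable_const (1 / Real.sqrt (2 * Real.pi * Δ))) fun A => by
      simp only
      gcongr
      rw [Real.exp_le_one_iff]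
      exact div_nonpos_of_nonpos_of_nonneg (by nlinarith [sq_nonneg (y - f s A)]) (by positivity)
  simpa [Pout] using this

lemma map_channel (hΔ : 0 < Δ) (hf : Measurable (Function.uncurry f)) (s : ℝ) :
    (stdG.prod PA).map (fun q => f s q.2 + Real.sqrt Δ * q.1) =
      volume.withDensity fun y => ENNReal.ofReal (Pout PA Δ f y s) := by
  have hfs := measurable_channel_arg hf s
  have hv : Δ.toNNReal ≠ 0 := (Real.toNNReal_pos.2 hΔ).ne'
  have hP : Measurable fun y => ENNReal.ofReal (Pout PA Δ f y s) :=
    ((measurable_Pout PA hf).comp measurable_prodMk_right).ennreal_ofReal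
  refine Measure.ext_of_lintegral _ fun h hh => ?_
  rw [lintegral_map hh (by fun_prop), lintegral_withDensity_eq_lintegral_mul _ hP hh,
    lintegral_prod_symm _ (by fun_prop)]
  have hg : ∀ A, ∫⁻ z, h (f s A + Real.sqrt Δ * z) ∂stdG =
      ∫⁻ y, ENNReal.ofReal (Real.exp (-(y - f s A) ^ 2 / (2 * Δ)) / Real.sqrt (2 * Real.pi * Δ)) *
        h y := by
    intro A
    have hl : stdG.map (fun z => f s A + Real.sqrt Δ * z) = gaussianReal (f s A) Δ.toNNReal := by
      rw [show (fun z => f s A + Real.sqrt Δ * z) =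
        (fun z => f s A + z) ∘ (fun z => Real.sqrt Δ * z) from rfl,
        ← Measure.map_map (by fun_prop) (by fun_prop), stdG, gaussianReal_map_const_mul,
        gaussianReal_map_const_add]
      congr 1
      · simp
      · ext; simp [Real.sq_sqrt hΔ.le, hΔ.le]
    rw [← lintegral_map (f := h) hh (by fun_prop), hl, gaussianReal_of_var_ne_zero _ hv,
      lintegral_withDensity_eq_lintegral_mul _ (measurable_gaussianPDF _ _) hh]
    refine lintegral_congr fun y => ?_
    simp only [Pi.mul_apply, gaussianPDF, gaussianPDFReal, Real.coe_toNNReal _ hΔ.le]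
    rw [inv_mul_eq_div]
  simp_rw [hg]
  rw [lintegral_lintegral_swap]
  · refine lintegral_congr fun y => ?_
    simp only [Pi.mul_apply]
    rw [lintegral_mul_const _ (by fun_prop), Pout, ofReal_integral_eq_lintegral_ofReal
      (integrable_Pout_integrand PA hΔ hf y s) (Filter.Eventually.of_forall fun A => by positivity)]
  · fun_prop

lemma lintegral_channel_pi (hΔ : 0 < Δ) (hf : Measurable (Function.uncurry f)) {n : ℕ}
    (s : Fin n → ℝ) {H : (Fin n → ℝ) → ℝ≥0∞} (hH : Measurable H) :
    ∫⁻ q, H (fun i => f (s i) (q.2 i) + Real.sqrt Δ * q.1 i)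
        ∂((stdGPi n).prod (Measure.pi fun _ : Fin n => PA)) =
      ∫⁻ y, (∏ i, ENNReal.ofReal (Pout PA Δ f (y i) (s i))) * H y := by
  have hfs := fun i => measurable_channel_arg hf (s i)
  have hP : ∀ i, Measurable fun y => ENNReal.ofReal (Pout PA Δ f y (s i)) := fun i =>
    ((measurable_Pout PA hf).comp measurable_prodMk_right).ennreal_ofReal
  have hmp := measurePreserving_arrowProdEquivProdArrow ℝ (Fin p → ℝ) (Fin n)
    (fun _ => stdG) (fun _ => PA)
  have hc : ∀ i, Measurable fun q : ℝ × (Fin p → ℝ) => f (s i) q.2 + Real.sqrt Δ * q.1 := by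
    intro i; have := hfs i; fun_prop
  have hHm : Measurable fun q : (Fin n → ℝ) × (Fin n → Fin p → ℝ) =>
      H (fun i => f (s i) (q.2 i) + Real.sqrt Δ * q.1 i) := by
    refine hH.comp (measurable_pi_lambda _ fun i => ?_)
    have := hfs i; fun_prop
  rw [stdGPi, ← hmp.lintegral_comp hHm]
  have hpr : ∀ i, IsProbabilityMeasure
      ((stdG.prod PA).map fun q => f (s i) q.2 + Real.sqrt Δ * q.1) := fun i =>
    Measure.isProbabilityMeasure_map (hc i).aemeasurable
  have hpr' : ∀ i, IsProbabilityMeasure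
      ((volume : Measure ℝ).withDensity fun y => ENNReal.ofReal (Pout PA Δ f y (s i))) := by
    intro i
    rw [← map_channel PA hΔ hf]; exact hpr i
  have h1 : ∫⁻ a : Fin n → ℝ × (Fin p → ℝ), H (fun i => f (s i) (a i).2 + Real.sqrt Δ * (a i).1)
      ∂(Measure.pi fun _ => stdG.prod PA)
      = ∫⁻ y, H y ∂((Measure.pi fun _ => stdG.prod PA).map
        fun a i => f (s i) (a i).2 + Real.sqrt Δ * (a i).1) :=
    (lintegral_map hH (measurable_pi_lambda _ fun i => (hc i).comp (measurable_pi_apply i))).symm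
  refine h1.trans ?_
  rw [Measure.pi_map_pi (f := fun i (q : ℝ × (Fin p → ℝ)) => f (s i) q.2 + Real.sqrt Δ * q.1)
    fun i => (hc i).aemeasurable]
  simp_rw [map_channel PA hΔ hf]
  have hP' : Measurable fun y : Fin n → ℝ => ∏ i, ENNReal.ofReal (Pout PA Δ f (y i) (s i)) :=
    Finset.measurable_prod _ fun i _ => (hP i).comp (measurable_pi_apply i)
  rw [pi_withDensity volume _ hP, lintegral_withDensity_eq_lintegral_mul _ hP' hH]
  rfl

end Channel

section Nishimori

variable {p : ℕ} (PA : Measure (Fin p → ℝ)) {Δ : ℝ}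
  {f : ℝ → (Fin p → ℝ) → ℝ} {T : Type*} [MeasurableSpace T] (P : Measure T) {n : ℕ}

/-- Likelihood of the responses `y` with indices in `S`, given the signals `s`. -/
def likelihood (Δ : ℝ) (f : ℝ → (Fin p → ℝ) → ℝ) (S : Finset (Fin n)) (y s : Fin n → ℝ) : ℝ≥0∞ :=
  ∏ i ∈ S, ENNReal.ofReal (Pout PA Δ f (y i) (s i))

/-- Responses to the signals `s`, with Gaussian noise `q.1` and channel randomness `q.2`. -/
def responses (Δ : ℝ) (f : ℝ → (Fin p → ℝ) → ℝ) (s : Fin n → ℝ)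
    (q : (Fin n → ℝ) × (Fin n → Fin p → ℝ)) : Fin n → ℝ :=
  fun i => f (s i) (q.2 i) + Real.sqrt Δ * q.1 i

/-- Posterior average of `g` given the responses `y` with indices in `S`. -/
def posteriorMean (Δ : ℝ) (f : ℝ → (Fin p → ℝ) → ℝ) (s : T → Fin n → ℝ) (S : Finset (Fin n))
    (g : T → ℝ≥0∞) (y : Fin n → ℝ) : ℝ≥0∞ :=
  (∫⁻ τ, likelihood PA Δ f S y (s τ) * g τ ∂P) / ∫⁻ τ, likelihood PA Δ f S y (s τ) ∂P

/-- Law of the output noise and of the channel randomness. -/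
def noiseMeasure (n : ℕ) : Measure ((Fin n → ℝ) × (Fin n → Fin p → ℝ)) :=
  (stdGPi n).prod (Measure.pi fun _ : Fin n => PA)

instance [IsProbabilityMeasure PA] : IsProbabilityMeasure (noiseMeasure PA n) := by
  unfold noiseMeasure; infer_instance

variable [IsProbabilityMeasure PA] [IsProbabilityMeasure P]

lemma measurable_likelihood (hf : Measurable (Function.uncurry f)) (S : Finset (Fin n)) :
    Measurable fun q : (Fin n → ℝ) × (Fin n → ℝ) => likelihood PA Δ f S q.1 q.2 := by
  refine Finset.measurable_prod _ fun i _ => ?_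
  have hi : Measurable fun q : (Fin n → ℝ) × (Fin n → ℝ) => ((q.1 i, q.2 i) : ℝ × ℝ) := by fun_prop
  exact ((measurable_Pout PA hf).comp hi).ennreal_ofReal

omit [IsProbabilityMeasure PA] [IsProbabilityMeasure P] in
lemma measurable_uncurry_signal {s : T → Fin n → ℝ} (hs : Measurable s)
    {F : (Fin n → ℝ) → (Fin n → ℝ) → ℝ≥0∞}
    (hF : Measurable fun q : (Fin n → ℝ) × (Fin n → ℝ) => F q.1 q.2) :
    Measurable fun q : (Fin n → ℝ) × T => F q.1 (s q.2) :=
  hF.comp (measurable_fst.prodMk (hs.comp measurable_snd))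

lemma measurable_posteriorMean (hf : Measurable (Function.uncurry f)) {s : T → Fin n → ℝ}
    (hs : Measurable s) (S : Finset (Fin n)) {g : T → ℝ≥0∞} (hg : Measurable g) :
    Measurable (posteriorMean PA P Δ f s S g) := by
  have hw := measurable_uncurry_signal hs (measurable_likelihood PA (Δ := Δ) hf S)
  exact (hw.mul (hg.comp measurable_snd)).lintegral_prod_right'.div hw.lintegral_prod_right'

/-- Bayes' rule: averaging the posterior mean of `g` over the marginal law of the observation
gives at most the prior mean of `g`. -/
lemma lintegral_posterior_le {Y : Type*} [MeasurableSpace Y] (ν : Measure Y) [SFinite ν]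
    {w : Y → T → ℝ≥0∞} (hw : Measurable fun q : Y × T => w q.1 q.2)
    (hw1 : ∀ τ, ∫⁻ y, w y τ ∂ν = 1) {g : T → ℝ≥0∞} (hg : Measurable g) :
    ∫⁻ τ, ∫⁻ y, w y τ * ((∫⁻ τ', w y τ' * g τ' ∂P) / ∫⁻ τ', w y τ' ∂P) ∂ν ∂P ≤ ∫⁻ τ, g τ ∂P := by
  have hm : Measurable fun y => (∫⁻ τ', w y τ' * g τ' ∂P) / ∫⁻ τ', w y τ' ∂P :=
    (hw.mul (hg.comp measurable_snd)).lintegral_prod_right'.div hw.lintegral_prod_right'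
  have hws : Measurable fun q : T × Y => w q.2 q.1 := hw.comp measurable_swap
  rw [lintegral_lintegral_swap (hws.mul (hm.comp measurable_snd)).aemeasurable]
  calc ∫⁻ y, ∫⁻ τ, w y τ * ((∫⁻ τ', w y τ' * g τ' ∂P) / ∫⁻ τ', w y τ' ∂P) ∂P ∂ν
      ≤ ∫⁻ y, ∫⁻ τ, w y τ * g τ ∂P ∂ν := by
        refine lintegral_mono fun y => ?_
        rw [lintegral_mul_const _ (f := fun τ => w y τ) (hw.comp measurable_prodMk_left)]
        exact ENNReal.mul_div_le
    _ = ∫⁻ τ, ∫⁻ y, w y τ * g τ ∂ν ∂P :=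
        lintegral_lintegral_swap (hw.mul (hg.comp measurable_snd)).aemeasurable
    _ = ∫⁻ τ, g τ ∂P := by
        refine lintegral_congr fun τ => ?_
        rw [lintegral_mul_const _ (f := fun y => w y τ) (hw.comp measurable_prodMk_right), hw1,
          one_mul]

/-- Nishimori inequality when every sample enters the posterior. -/
lemma nishimori_univ (hΔ : 0 < Δ) (hf : Measurable (Function.uncurry f)) {s : T → Fin n → ℝ}
    (hs : Measurable s) {g : T → ℝ≥0∞} (hg : Measurable g) :
    ∫⁻ τ, ∫⁻ q, posteriorMean PA P Δ f s Finset.univ g (responses Δ f (s τ) q)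
        ∂(noiseMeasure PA n) ∂P ≤ ∫⁻ τ, g τ ∂P := by
  have hw := measurable_uncurry_signal hs (measurable_likelihood PA (Δ := Δ) hf Finset.univ)
  have hm := measurable_posteriorMean PA P (Δ := Δ) hf hs Finset.univ hg
  have hlaw : ∀ (τ : T) {H : (Fin n → ℝ) → ℝ≥0∞}, Measurable H →
      ∫⁻ q, H (responses Δ f (s τ) q) ∂(noiseMeasure PA n) =
        ∫⁻ y, likelihood PA Δ f Finset.univ y (s τ) * H y := fun τ H hH =>
    lintegral_channel_pi PA hΔ hf (s τ) hH
  rw [lintegral_congr fun τ => hlaw τ hm]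
  refine lintegral_posterior_le P volume hw (fun τ => ?_) hg
  simpa using (hlaw τ (H := fun _ => 1) measurable_const).symm

/-- Nishimori inequality: a posterior average built from the samples in `S` is, in mean, at most
the corresponding prior average. -/
lemma nishimori (hΔ : 0 < Δ) (hf : Measurable (Function.uncurry f)) {s : T → Fin n → ℝ}
    (hs : Measurable s) (S : Finset (Fin n)) {g : T → ℝ≥0∞} (hg : Measurable g) :
    ∫⁻ τ, ∫⁻ q, posteriorMean PA P Δ f s S g (responses Δ f (s τ) q) ∂(noiseMeasure PA n) ∂P ≤
      ∫⁻ τ, g τ ∂P := by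
  classical
  let s' : T → Fin n → ℝ := fun τ i => if i ∈ S then s τ i else 0
  have hs' : Measurable s' := by
    refine measurable_pi_lambda _ fun i => ?_
    by_cases hi : i ∈ S
    · simpa [s', hi, Function.comp_def] using (measurable_pi_apply i).comp hs
    · simp [s', hi]
  refine le_trans (le_of_eq ?_) (nishimori_univ PA P hΔ hf hs' hg)
  refine lintegral_congr fun τ => lintegral_congr fun q => ?_
  set c : ℝ≥0∞ := ∏ i ∈ Sᶜ, ENNReal.ofReal
    (Pout PA Δ f (f 0 (q.2 i) + Real.sqrt Δ * q.1 i) 0) with hc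
  have hc0 : c ≠ 0 := by
    rw [hc, Finset.prod_ne_zero_iff]
    exact fun i _ => (ENNReal.ofReal_pos.2 (Pout_pos PA hΔ hf _ _)).ne'
  have hct : c ≠ ∞ := ENNReal.prod_ne_top fun i _ => ENNReal.ofReal_ne_top
  have hprod : ∀ τ', likelihood PA Δ f Finset.univ (responses Δ f (s' τ) q) (s' τ') =
      c * likelihood PA Δ f S (responses Δ f (s τ) q) (s τ') := fun τ' => by
    rw [likelihood, ← Finset.prod_compl_mul_prod S, hc]
    congr 1
    · refine Finset.prod_congr rfl fun i hi => ?_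
      simp [s', responses, Finset.mem_compl.1 hi]
    · exact Finset.prod_congr rfl fun i hi => by simp [s', responses, hi]
  simp_rw [posteriorMean, hprod, mul_assoc]
  rw [lintegral_const_mul' _ _ hct, lintegral_const_mul' _ _ hct,
    ENNReal.mul_div_mul_left _ _ hc0 hct]

end Nishimori

section Network

variable {φ : ℝ → ℝ} {d : ℕ → ℕ} {L : ℕ}

lemma measurable_extW (ℓ : ℕ) (i : Fin (d (ℓ + 1))) (j : Fin (d ℓ)) :
    Measurable fun W : Wspace d L => extW W ℓ i j := by
  by_cases h : ℓ < L
  · simp only [extW, h, dif_pos]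
    exact (measurable_pi_apply j).comp ((measurable_pi_apply i).comp (measurable_pi_apply _))
  · simp only [extW, h, dif_neg, not_false_eq_true, Pi.zero_apply]
    exact measurable_const

lemma measurable_feat (hφ : Measurable φ) (ℓ : ℕ) (i : Fin (d ℓ)) :
    Measurable fun q : Wspace d L × (Fin (d 0) → ℝ) => feat φ d (extW q.1) q.2 ℓ i := by
  induction ℓ with
  | zero => exact (measurable_pi_apply i).comp measurable_snd
  | succ ℓ ih =>
    refine hφ.comp (Measurable.div_const (Finset.measurable_sum _ fun j _ => ?_) _)
    exact ((measurable_extW ℓ i j).comp measurable_fst).mul (ih j)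

lemma measurable_netOut (hφ : Measurable φ) :
    Measurable fun q : (Wspace d L × (Fin (d L) → ℝ)) × (Fin (d 0) → ℝ) =>
      netOut φ d L q.1.1 q.1.2 q.2 := by
  refine Measurable.div_const (Finset.measurable_sum _ fun j _ => ?_) _
  refine Measurable.mul (by fun_prop) ?_
  exact (measurable_feat hφ L j).comp
    (f := fun q : (Wspace d L × (Fin (d L) → ℝ)) × (Fin (d 0) → ℝ) => (q.1.1, q.2)) (by fun_prop)

/-- The component of the interpolating signal that is linear in the last hidden features. -/
def linOut (φ : ℝ → ℝ) (d : ℕ → ℕ) (L : ℕ) (W : Wspace d L) (v : Fin (d (L - 1)) → ℝ)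
    (x0 : Fin (d 0) → ℝ) : ℝ :=
  (∑ j, v j * feat φ d (extW W) x0 (L - 1) j) / Real.sqrt (d (L - 1) : ℝ)

lemma measurable_linOut (hφ : Measurable φ) :
    Measurable fun q : (Wspace d L × (Fin (d (L - 1)) → ℝ)) × (Fin (d 0) → ℝ) =>
      linOut φ d L q.1.1 q.1.2 q.2 := by
  refine Measurable.div_const (Finset.measurable_sum _ fun j _ => ?_) _
  refine Measurable.mul (by fun_prop) ?_
  exact (measurable_feat hφ (L - 1) j).comp
    (f := fun q : (Wspace d L × (Fin (d (L - 1)) → ℝ)) × (Fin (d 0) → ℝ) => (q.1.1, q.2))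
    (by fun_prop)

lemma measurable_stI (hφ : Measurable φ) (n : ℕ) (t : ℝ) :
    Measurable fun q : (Fin n → Fin (d 0) → ℝ) × studSpace d L n => stI φ d L n t q.1 q.2 := by
  refine measurable_pi_lambda _ fun μ => ?_
  refine ((Measurable.const_mul ?_ _).add (Measurable.const_mul ?_ _)).add
    (Measurable.const_mul (by fun_prop) _)
  · exact (measurable_netOut hφ).comp
      (f := fun q : (Fin n → Fin (d 0) → ℝ) × studSpace d L n => ((q.2.1, q.2.2.1), q.1 μ))
      (by fun_prop)
  · exact (measurable_linOut hφ).comp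
      (f := fun q : (Fin n → Fin (d 0) → ℝ) × studSpace d L n => ((q.2.1, q.2.2.2.1), q.1 μ))
      (by fun_prop)

lemma feat_congr {W W' : (ℓ : ℕ) → Fin (d (ℓ + 1)) → Fin (d ℓ) → ℝ} (x0 : Fin (d 0) → ℝ) {ℓ : ℕ}
    (h : ∀ k < ℓ, W k = W' k) : feat φ d W x0 ℓ = feat φ d W' x0 ℓ := by
  induction ℓ with
  | zero => rfl
  | succ ℓ ih =>
    funext i
    simp only [feat, h ℓ ℓ.lt_succ_self, ih fun k hk => h k (hk.trans ℓ.lt_succ_self)]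

/-- Empirical fourth moment of a vector. -/
def meanFour {k : ℕ} (u : Fin k → ℝ) : ℝ≥0∞ := (∑ j, ENNReal.ofReal (u j ^ 4)) / k

lemma lintegral_linear_pow_four_le {k : ℕ} (u : Fin k → ℝ) :
    ∫⁻ a, ENNReal.ofReal (((∑ j, a j * u j) / Real.sqrt k) ^ 4) ∂(stdGPi k) ≤
      gaussFourth * meanFour u := lintegral_linear_pow_four u

lemma lintegral_preactivation_pow_four_le (hφ : Measurable φ) (x0 : Fin (d 0) → ℝ) {ℓ : ℕ}
    (h : ℓ < L) (i : Fin (d (ℓ + 1))) :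
    ∫⁻ W, ENNReal.ofReal (((∑ j, extW W ℓ i j * feat φ d (extW W) x0 ℓ j) /
        Real.sqrt (d ℓ)) ^ 4) ∂(Wmeasure d L) ≤
      gaussFourth * ∫⁻ W, meanFour (feat φ d (extW W) x0 ℓ) ∂(Wmeasure d L) := by
  have hm : Measurable fun W : Wspace d L => feat φ d (extW W) x0 ℓ :=
    measurable_pi_lambda _ fun j => (measurable_feat hφ ℓ j).comp measurable_prodMk_right
  have hG : Measurable fun W : Wspace d L => ENNReal.ofReal
      (((∑ j, extW W ℓ i j * feat φ d (extW W) x0 ℓ j) / Real.sqrt (d ℓ)) ^ 4) := by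
    refine ((Measurable.div_const (Finset.measurable_sum _ fun j _ => ?_) _).pow_const
      4).ennreal_ofReal
    exact (measurable_extW ℓ i j).mul ((measurable_pi_apply j).comp hm)
  have hup := measurePreserving_update
    (fun ℓ : Fin L => Measure.pi fun _ : Fin (d ((ℓ : ℕ) + 1)) => stdGPi (d (ℓ : ℕ))) ⟨ℓ, h⟩
  have hfeat : ∀ (W : Wspace d L) V, feat φ d (extW (Function.update W ⟨ℓ, h⟩ V)) x0 ℓ =
      feat φ d (extW W) x0 ℓ := fun W V => feat_congr x0 fun k hk => by
    have hkL : k < L := hk.trans h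
    simp only [extW, hkL, dif_pos]
    exact Function.update_of_ne (by simpa [Fin.ext_iff] using hk.ne) _ _
  have hrow : ∀ (W : Wspace d L) V, extW (Function.update W ⟨ℓ, h⟩ V) ℓ = V := fun W V => by
    simp [extW, h]
  rw [Wmeasure, ← hup.lintegral_comp hG]
  have hG' := hG.comp hup.measurable
  simp only [Function.comp_def] at hG'
  rw [lintegral_prod _ hG'.aemeasurable, ← lintegral_const_mul' _ _ gaussFourth_lt_top.ne]
  refine lintegral_mono fun W => ?_
  simp only [hfeat, hrow]
  have hrm : Measurable fun r : Fin (d ℓ) → ℝ => ENNReal.ofReal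
      (((∑ j, r j * feat φ d (extW W) x0 ℓ j) / Real.sqrt (d ℓ)) ^ 4) := by fun_prop
  rw [(measurePreserving_eval (fun _ : Fin (d (ℓ + 1)) => stdGPi (d ℓ)) i).lintegral_comp hrm]
  exact lintegral_linear_pow_four_le _

lemma measurable_meanFour {k : ℕ} : Measurable (meanFour (k := k)) := by
  unfold meanFour
  fun_prop

lemma lintegral_meanFour_feat_le (hφ : Measurable φ) {K : ℝ} (hK : ∀ x, |φ x| ≤ K * |x|)
    (x0 : Fin (d 0) → ℝ) {ℓ : ℕ} (h : ℓ ≤ L) :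
    ∫⁻ W, meanFour (feat φ d (extW W) x0 ℓ) ∂(Wmeasure d L) ≤
      (ENNReal.ofReal (K ^ 4) * gaussFourth) ^ ℓ * meanFour x0 := by
  induction ℓ with
  | zero => simp [feat]
  | succ ℓ ih =>
    have hm : ∀ j, Measurable fun W : Wspace d L => feat φ d (extW W) x0 (ℓ + 1) j := fun j =>
      (measurable_feat hφ (ℓ + 1) j).comp measurable_prodMk_right
    set c := ENNReal.ofReal (K ^ 4) * gaussFourth with hc
    set m := ∫⁻ W, meanFour (feat φ d (extW W) x0 ℓ) ∂(Wmeasure d L) with hmdef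
    have hrow : ∀ i, ∫⁻ W, ENNReal.ofReal (feat φ d (extW W) x0 (ℓ + 1) i ^ 4) ∂(Wmeasure d L) ≤
        c * m := fun i => by
      rw [hc, mul_assoc]
      refine le_trans ?_ (mul_le_mul_right (lintegral_preactivation_pow_four_le hφ x0 h i) _)
      rw [← lintegral_const_mul' _ _ ENNReal.ofReal_ne_top]
      refine lintegral_mono fun W => ?_
      dsimp only
      rw [← ENNReal.ofReal_mul (by positivity), feat]
      refine ENNReal.ofReal_le_ofReal ?_
      rw [← mul_pow, ← (by decide : Even 4).pow_abs, ← (by decide : Even 4).pow_abs (K * _)]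
      refine pow_le_pow_left₀ (abs_nonneg _) ((hK _).trans ?_) 4
      rw [abs_mul]
      exact mul_le_mul_of_nonneg_right (le_abs_self K) (abs_nonneg _)
    calc ∫⁻ W, meanFour (feat φ d (extW W) x0 (ℓ + 1)) ∂(Wmeasure d L)
        = (∑ i, ∫⁻ W, ENNReal.ofReal (feat φ d (extW W) x0 (ℓ + 1) i ^ 4) ∂(Wmeasure d L)) /
            d (ℓ + 1) := by
          simp only [meanFour, div_eq_mul_inv]
          rw [lintegral_mul_const _ (by fun_prop), lintegral_finsetSum _ (by fun_prop)]
      _ ≤ (∑ _i : Fin (d (ℓ + 1)), c * m) / d (ℓ + 1) := by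
          gcongr with i
          exact hrow i
      _ ≤ c * m := by
          rw [Finset.sum_const, Finset.card_univ, Fintype.card_fin, nsmul_eq_mul,
            div_eq_mul_inv, mul_right_comm, ← div_eq_mul_inv]
          exact mul_le_of_le_one_left' ENNReal.div_self_le_one
      _ ≤ c * (c ^ ℓ * meanFour x0) := mul_le_mul_right (ih (Nat.le_of_succ_le h)) _
      _ = c ^ (ℓ + 1) * meanFour x0 := by rw [pow_succ']; ring

lemma lintegral_meanFour_gaussian_le (k : ℕ) :
    ∫⁻ x, meanFour x ∂(stdGPi k) ≤ gaussFourth := by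
  have hj : ∀ j, ∫⁻ x, ENNReal.ofReal (x j ^ 4) ∂(stdGPi k) = gaussFourth := fun j =>
    (measurePreserving_eval (fun _ : Fin k => stdG) j).lintegral_comp
      (f := fun z => ENNReal.ofReal (z ^ 4)) (by fun_prop)
  simp only [meanFour, div_eq_mul_inv]
  rw [lintegral_mul_const _ (by fun_prop), lintegral_finsetSum _ (by fun_prop)]
  simp only [hj, Finset.sum_const, Finset.card_univ, Fintype.card_fin, nsmul_eq_mul]
  rw [mul_right_comm, ← div_eq_mul_inv]
  exact mul_le_of_le_one_left' ENNReal.div_self_le_one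

end Network

lemma abs_le_mul_abs_of_odd {g : ℝ → ℝ} (hg : Differentiable ℝ g) (hodd : ∀ x, g (-x) = -g x)
    {K : ℝ} (hK : ∀ x, |deriv g x| ≤ K) (x : ℝ) : |g x| ≤ K * |x| := by
  have h0 : g 0 = 0 := by
    have := hodd 0
    rw [neg_zero] at this
    linarith
  simpa [h0] using convex_univ.norm_image_sub_le_of_norm_deriv_le (f := g) (x := 0) (y := x)
    (fun y _ => hg y) (fun y _ => hK y) (Set.mem_univ _) (Set.mem_univ _)

lemma add_three_pow_four_le (x y z : ℝ) :
    (x + y + z) ^ 4 ≤ 27 * (x ^ 4 + y ^ 4 + z ^ 4) := by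
  have h1 : (x + y + z) ^ 2 ≤ 3 * (x ^ 2 + y ^ 2 + z ^ 2) := by
    nlinarith [sq_nonneg (x - y), sq_nonneg (y - z), sq_nonneg (x - z)]
  have h2 : (x ^ 2 + y ^ 2 + z ^ 2) ^ 2 ≤ 3 * (x ^ 4 + y ^ 4 + z ^ 4) := by
    nlinarith [sq_nonneg (x ^ 2 - y ^ 2), sq_nonneg (y ^ 2 - z ^ 2), sq_nonneg (x ^ 2 - z ^ 2)]
  nlinarith [pow_le_pow_left₀ (sq_nonneg (x + y + z)) h1 2]

lemma sqrt_pow_four_le {x y : ℝ} (h : x ≤ y) (hy : 0 ≤ y) : Real.sqrt x ^ 4 ≤ y ^ 2 := by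
  have h1 : Real.sqrt x ^ 2 ≤ y := by
    rw [← Real.sq_sqrt hy]
    exact pow_le_pow_left₀ (Real.sqrt_nonneg _) (Real.sqrt_le_sqrt h) 2
  calc Real.sqrt x ^ 4 = (Real.sqrt x ^ 2) ^ 2 := by ring
    _ ≤ y ^ 2 := pow_le_pow_left₀ (sq_nonneg _) h1 2

section Signal

variable {φ : ℝ → ℝ} {d : ℕ → ℕ} {L : ℕ}

/-- Dimension-free bound on the fourth moment of the interpolating signal. -/
def signalFourBound (φ : ℝ → ℝ) (L : ℕ) (K : ℝ) : ℝ≥0∞ :=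
  27 * (gaussFourth * (ENNReal.ofReal (K ^ 4) * gaussFourth) ^ L * gaussFourth +
    ENNReal.ofReal (rhoC φ L ^ 4) *
      (gaussFourth * (ENNReal.ofReal (K ^ 4) * gaussFourth) ^ (L - 1) * gaussFourth) +
    ENNReal.ofReal (epsC φ L ^ 2) * gaussFourth)

lemma signalFourBound_lt_top (K : ℝ) : signalFourBound φ L K < ∞ := by
  have h := gaussFourth_lt_top
  have hc : ∀ m : ℕ, (ENNReal.ofReal (K ^ 4) * gaussFourth) ^ m < ∞ := fun m =>
    ENNReal.pow_lt_top (ENNReal.mul_lt_top ENNReal.ofReal_lt_top h)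
  unfold signalFourBound
  refine ENNReal.mul_lt_top (by simp) (ENNReal.add_lt_top.2 ⟨ENNReal.add_lt_top.2 ⟨?_, ?_⟩, ?_⟩)
  · exact ENNReal.mul_lt_top (ENNReal.mul_lt_top h (hc _)) h
  · exact ENNReal.mul_lt_top ENNReal.ofReal_lt_top
      (ENNReal.mul_lt_top (ENNReal.mul_lt_top h (hc _)) h)
  · exact ENNReal.mul_lt_top ENNReal.ofReal_lt_top h

lemma stI_pow_four_le {n : ℕ} {t : ℝ} (ht0 : 0 ≤ t) (ht1 : t ≤ 1) (X : Fin n → Fin (d 0) → ℝ)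
    (τ : studSpace d L n) (μ : Fin n) :
    ENNReal.ofReal (stI φ d L n t X τ μ ^ 4) ≤
      27 * (ENNReal.ofReal (netOut φ d L τ.1 τ.2.1 (X μ) ^ 4) +
        ENNReal.ofReal (rhoC φ L ^ 4) * ENNReal.ofReal (linOut φ d L τ.1 τ.2.2.1 (X μ) ^ 4) +
        ENNReal.ofReal (epsC φ L ^ 2) * ENNReal.ofReal (τ.2.2.2 μ ^ 4)) := by
  have h4 : ∀ x : ℝ, 0 ≤ x ^ 4 := fun x => (by decide : Even 4).pow_nonneg x
  have h27 : (27 : ℝ≥0∞) = ENNReal.ofReal 27 := by simp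
  rw [h27, ← ENNReal.ofReal_mul (h4 _), ← ENNReal.ofReal_mul (sq_nonneg _),
    ← ENNReal.ofReal_add (h4 _) (mul_nonneg (h4 _) (h4 _)),
    ← ENNReal.ofReal_add (add_nonneg (h4 _) (mul_nonneg (h4 _) (h4 _)))
      (mul_nonneg (sq_nonneg _) (h4 _)),
    ← ENNReal.ofReal_mul (by norm_num)]
  refine ENNReal.ofReal_le_ofReal ?_
  refine (add_three_pow_four_le _ _ _).trans (mul_le_mul_of_nonneg_left ?_ (by norm_num))
  rw [mul_pow, mul_pow, mul_pow, mul_pow]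
  have e1 : Real.sqrt (1 - t) ^ 4 ≤ 1 := by
    simpa using sqrt_pow_four_le (x := 1 - t) (y := 1) (by linarith) zero_le_one
  have e2 : Real.sqrt t ^ 4 ≤ 1 := by
    simpa using sqrt_pow_four_le (x := t) (y := 1) ht1 zero_le_one
  have e3 : Real.sqrt (t * epsC φ L) ^ 4 ≤ epsC φ L ^ 2 := by
    rw [← sq_abs (epsC φ L)]
    refine sqrt_pow_four_le ?_ (abs_nonneg _)
    calc t * epsC φ L ≤ t * |epsC φ L| := mul_le_mul_of_nonneg_left (le_abs_self _) ht0
      _ ≤ |epsC φ L| := mul_le_of_le_one_left (abs_nonneg _) ht1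
  refine add_le_add (add_le_add (mul_le_of_le_one_left (h4 _) e1) ?_)
    (mul_le_mul_of_nonneg_right e3 (h4 _))
  exact mul_le_mul_of_nonneg_right (mul_le_of_le_one_left (h4 _) e2) (h4 _)

lemma lintegral_netOut_pow_four_le (hφ : Measurable φ) {K : ℝ} (hK : ∀ x, |φ x| ≤ K * |x|)
    (x0 : Fin (d 0) → ℝ) :
    ∫⁻ W, ∫⁻ a, ENNReal.ofReal (netOut φ d L W a x0 ^ 4) ∂(stdGPi (d L)) ∂(Wmeasure d L) ≤
      gaussFourth * (ENNReal.ofReal (K ^ 4) * gaussFourth) ^ L * meanFour x0 := by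
  calc _ ≤ ∫⁻ W, gaussFourth * meanFour (feat φ d (extW W) x0 L) ∂(Wmeasure d L) :=
        lintegral_mono fun W => lintegral_linear_pow_four_le _
    _ = gaussFourth * ∫⁻ W, meanFour (feat φ d (extW W) x0 L) ∂(Wmeasure d L) :=
        lintegral_const_mul' _ _ gaussFourth_lt_top.ne
    _ ≤ _ := by
        rw [mul_assoc]
        exact mul_le_mul_right (lintegral_meanFour_feat_le hφ hK x0 le_rfl) _

lemma lintegral_linOut_pow_four_le (hφ : Measurable φ) {K : ℝ} (hK : ∀ x, |φ x| ≤ K * |x|)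
    (x0 : Fin (d 0) → ℝ) :
    ∫⁻ W, ∫⁻ v, ENNReal.ofReal (linOut φ d L W v x0 ^ 4) ∂(stdGPi (d (L - 1))) ∂(Wmeasure d L) ≤
      gaussFourth * (ENNReal.ofReal (K ^ 4) * gaussFourth) ^ (L - 1) * meanFour x0 := by
  calc _ ≤ ∫⁻ W, gaussFourth * meanFour (feat φ d (extW W) x0 (L - 1)) ∂(Wmeasure d L) :=
        lintegral_mono fun W => lintegral_linear_pow_four_le _
    _ = gaussFourth * ∫⁻ W, meanFour (feat φ d (extW W) x0 (L - 1)) ∂(Wmeasure d L) :=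
        lintegral_const_mul' _ _ gaussFourth_lt_top.ne
    _ ≤ _ := by
        rw [mul_assoc]
        exact mul_le_mul_right (lintegral_meanFour_feat_le hφ hK x0 (Nat.sub_le L 1)) _

lemma lintegral_stI_pow_four_le_of_input (hφ : Measurable φ) {K : ℝ} (hK : ∀ x, |φ x| ≤ K * |x|)
    {n : ℕ} {t : ℝ} (ht0 : 0 ≤ t) (ht1 : t ≤ 1) (X : Fin n → Fin (d 0) → ℝ) (μ : Fin n) :
    ∫⁻ τ, ENNReal.ofReal (stI φ d L n t X τ μ ^ 4) ∂(studMeasure d L n) ≤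
      27 * (gaussFourth * (ENNReal.ofReal (K ^ 4) * gaussFourth) ^ L * meanFour (X μ) +
        ENNReal.ofReal (rhoC φ L ^ 4) *
          (gaussFourth * (ENNReal.ofReal (K ^ 4) * gaussFourth) ^ (L - 1) * meanFour (X μ)) +
        ENNReal.ofReal (epsC φ L ^ 2) * gaussFourth) := by
  have hN : Measurable fun q : Wspace d L × (Fin (d L) → ℝ) => netOut φ d L q.1 q.2 (X μ) :=
    (measurable_netOut hφ).comp measurable_prodMk_right
  have hV : Measurable fun q : Wspace d L × (Fin (d (L - 1)) → ℝ) => linOut φ d L q.1 q.2 (X μ) :=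
    (measurable_linOut hφ).comp measurable_prodMk_right
  have mN : Measurable fun τ : studSpace d L n =>
      ENNReal.ofReal (netOut φ d L τ.1 τ.2.1 (X μ) ^ 4) :=
    ((hN.comp (f := fun τ : studSpace d L n => (τ.1, τ.2.1)) (by fun_prop)).pow_const
      4).ennreal_ofReal
  have mV : Measurable fun τ : studSpace d L n =>
      ENNReal.ofReal (linOut φ d L τ.1 τ.2.2.1 (X μ) ^ 4) :=
    ((hV.comp (f := fun τ : studSpace d L n => (τ.1, τ.2.2.1)) (by fun_prop)).pow_const
      4).ennreal_ofReal
  have mZ : Measurable fun τ : studSpace d L n => ENNReal.ofReal (τ.2.2.2 μ ^ 4) := by fun_prop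
  refine (lintegral_mono fun τ => stI_pow_four_le ht0 ht1 X τ μ).trans ?_
  rw [lintegral_const_mul' _ _ (by simp), lintegral_add_right _ (mZ.const_mul _),
    lintegral_add_left mN, lintegral_const_mul' _ _ ENNReal.ofReal_ne_top,
    lintegral_const_mul' _ _ ENNReal.ofReal_ne_top]
  have bN := lintegral_netOut_pow_four_le (L := L) hφ hK (X μ)
  have bV := lintegral_linOut_pow_four_le (L := L) hφ hK (X μ)
  gcongr
  · refine le_trans (le_of_eq ?_) bN
    rw [studMeasure, lintegral_prod _ mN.aemeasurable]
    refine lintegral_congr fun W => ?_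
    exact measurePreserving_fst.lintegral_comp
      (f := fun a => ENNReal.ofReal (netOut φ d L W a (X μ) ^ 4))
      (((hN.comp measurable_prodMk_left).pow_const 4).ennreal_ofReal)
  · refine le_trans (le_of_eq ?_) bV
    rw [studMeasure, lintegral_prod _ mV.aemeasurable]
    refine lintegral_congr fun W => ?_
    exact (measurePreserving_fst.comp measurePreserving_snd).lintegral_comp
      (f := fun a => ENNReal.ofReal (linOut φ d L W a (X μ) ^ 4))
      (((hV.comp measurable_prodMk_left).pow_const 4).ennreal_ofReal)
  · refine le_of_eq ?_
    have hp : MeasurePreserving (fun τ : studSpace d L n => τ.2.2.2 μ) (studMeasure d L n) stdG :=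
      (measurePreserving_eval (fun _ : Fin n => stdG) μ).comp
        (measurePreserving_snd.comp (measurePreserving_snd.comp measurePreserving_snd))
    exact hp.lintegral_comp (f := fun z => ENNReal.ofReal (z ^ 4)) (by fun_prop)

/-- The fourth moment of the interpolating signal is bounded uniformly in the dimensions. -/
lemma lintegral_stI_pow_four_le (hφ : Measurable φ) {K : ℝ} (hK : ∀ x, |φ x| ≤ K * |x|)
    {n : ℕ} {t : ℝ} (ht0 : 0 ≤ t) (ht1 : t ≤ 1) (μ : Fin n) :
    ∫⁻ X, ∫⁻ τ, ENNReal.ofReal (stI φ d L n t X τ μ ^ 4) ∂(studMeasure d L n)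
      ∂(Measure.pi fun _ : Fin n => stdGPi (d 0)) ≤ signalFourBound φ L K := by
  refine (lintegral_mono fun X =>
    lintegral_stI_pow_four_le_of_input hφ hK ht0 ht1 X μ).trans ?_
  have hm : Measurable fun X : Fin n → Fin (d 0) → ℝ => meanFour (X μ) :=
    measurable_meanFour.comp (measurable_pi_apply μ)
  have hX : ∫⁻ X, meanFour (X μ) ∂(Measure.pi fun _ : Fin n => stdGPi (d 0)) ≤ gaussFourth := by
    rw [(measurePreserving_eval (fun _ : Fin n => stdGPi (d 0)) μ).lintegral_comp
      measurable_meanFour]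
    exact lintegral_meanFour_gaussian_le _
  rw [lintegral_const_mul' _ _ (by simp),
    lintegral_add_right _ measurable_const,
    lintegral_add_left (hm.const_mul _), lintegral_const_mul _ hm,
    lintegral_const_mul _ (hm.const_mul _), lintegral_const_mul _ hm, lintegral_const,
    measure_univ, mul_one, signalFourBound]
  gcongr

end Signal

/-- Jensen's inequality for the logarithm: if `exp (-B) ≤ h ≤ 1`, then `(log ∫ h) ^ 2` is at most
the second moment of `B`. -/
lemma sq_log_integral_le {α : Type*} [MeasurableSpace α] {π : Measure α} [IsProbabilityMeasure π]
    {h B : α → ℝ} (hh : Measurable h) (hB : Measurable B) (hB0 : ∀ x, 0 ≤ B x)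
    (hlo : ∀ x, Real.exp (-B x) ≤ h x) (hhi : ∀ x, h x ≤ 1) :
    ENNReal.ofReal (Real.log (∫ x, h x ∂π) ^ 2) ≤ ∫⁻ x, ENNReal.ofReal (B x ^ 2) ∂π := by
  by_cases htop : ∫⁻ x, ENNReal.ofReal (B x ^ 2) ∂π = ∞
  · simp [htop]
  have hpos : ∀ x, 0 < h x := fun x => (Real.exp_pos _).trans_le (hlo x)
  have hhint : Integrable h π := integrable_of_measurable_bounded hh (M := 1) fun x => by
    rw [abs_of_pos (hpos x)]; exact hhi x
  have hB2 : Integrable (fun x => B x ^ 2) π := by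
    refine ⟨(hB.pow_const 2).aestronglyMeasurable, ?_⟩
    rw [hasFiniteIntegral_iff_ofReal (Filter.Eventually.of_forall fun x => sq_nonneg _)]
    exact lt_top_iff_ne_top.2 htop
  have hBL : MemLp B 2 π := (memLp_two_iff_integrable_sq hB.aestronglyMeasurable).2 hB2
  have hBint : Integrable B π := hBL.integrable (by norm_num)
  have hexpint : Integrable (fun x => Real.exp (-B x)) π :=
    integrable_of_measurable_bounded (M := 1) hB.neg.exp fun x => by
      rw [abs_of_pos (Real.exp_pos _)]
      exact Real.exp_le_one_iff.2 (neg_nonpos.2 (hB0 x))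
  have hjensen : Real.exp (-∫ x, B x ∂π) ≤ ∫ x, h x ∂π := by
    have := convexOn_exp.map_integral_le (μ := π) (f := fun x => -B x)
      Real.continuous_exp.continuousOn isClosed_univ (by simp) hBint.neg hexpint
    rw [integral_neg] at this
    exact this.trans (integral_mono hexpint hhint hlo)
  have hle1 : ∫ x, h x ∂π ≤ 1 := by
    simpa using integral_mono hhint (integrable_const (1 : ℝ)) hhi
  have hlogle : Real.log (∫ x, h x ∂π) ≤ 0 :=
    Real.log_nonpos (integral_nonneg fun x => (hpos x).le) hle1
  have hlogge : -∫ x, B x ∂π ≤ Real.log (∫ x, h x ∂π) :=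
    (Real.le_log_iff_exp_le ((Real.exp_pos _).trans_le hjensen)).2 hjensen
  have hsq : Real.log (∫ x, h x ∂π) ^ 2 ≤ ∫ x, B x ^ 2 ∂π := by
    refine le_trans ?_ (sq_integral_le_integral_sq hBL)
    rw [← neg_sq (Real.log _)]
    exact pow_le_pow_left₀ (by linarith) (by linarith) 2
  rw [← ofReal_integral_eq_lintegral_ofReal hB2 (Filter.Eventually.of_forall fun x => sq_nonneg _)]
  exact ENNReal.ofReal_le_ofReal hsq

section Increment

variable {p : ℕ} (PA : Measure (Fin p → ℝ)) [IsProbabilityMeasure PA] {Δ : ℝ}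
  {f : ℝ → (Fin p → ℝ) → ℝ} {T : Type*} [MeasurableSpace T] (P : Measure T)
  [IsProbabilityMeasure P] {n : ℕ}

lemma le_Pout (hΔ : 0 < Δ) (hf : Measurable (Function.uncurry f)) {K : ℝ}
    (hK : ∀ x A, |f x A| ≤ K * |x|) (y s : ℝ) :
    Real.exp (-((y ^ 2 + K ^ 2 * s ^ 2) / Δ)) / Real.sqrt (2 * Real.pi * Δ) ≤ Pout PA Δ f y s := by
  have h := integral_mono (μ := PA)
    (integrable_const (Real.exp (-((y ^ 2 + K ^ 2 * s ^ 2) / Δ)) / Real.sqrt (2 * Real.pi * Δ)))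
    (integrable_Pout_integrand PA hΔ hf y s) (fun A => by
      refine div_le_div_of_nonneg_right (Real.exp_le_exp.2 ?_) (Real.sqrt_nonneg _)
      have h1 : f s A ^ 2 ≤ K ^ 2 * s ^ 2 := by
        rw [← sq_abs, ← sq_abs s, ← mul_pow]
        exact pow_le_pow_left₀ (abs_nonneg _) (hK s A) 2
      rw [neg_div, neg_le_neg_iff, div_le_div_iff₀ (by positivity) hΔ]
      nlinarith [sq_nonneg (y + f s A), mul_nonneg hΔ.le (sq_nonneg (y + f s A)),
        mul_le_mul_of_nonneg_left h1 hΔ.le])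
  simpa [Pout] using h

omit [IsProbabilityMeasure P] in
lemma measurable_Pout_signal (hf : Measurable (Function.uncurry f)) {h : T → ℝ}
    (hh : Measurable h) (y : ℝ) : Measurable fun τ => Pout PA Δ f y (h τ) := by
  have hm := measurable_Pout PA (Δ := Δ) hf
  have hp : Measurable fun τ => ((y, h τ) : ℝ × ℝ) := measurable_const.prodMk hh
  generalize Pout PA Δ f = G at hm ⊢
  exact hm.comp hp

/-- Log-partition function built from the samples in `S`. -/
def logPart (Δ : ℝ) (f : ℝ → (Fin p → ℝ) → ℝ) (s : T → Fin n → ℝ) (S : Finset (Fin n))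
    (y : Fin n → ℝ) : ℝ :=
  Real.log (∫⁻ τ, likelihood PA Δ f S y (s τ) ∂P).toReal

lemma lintegral_likelihood_ne_top (hΔ : 0 < Δ) (hf : Measurable (Function.uncurry f))
    (s : T → Fin n → ℝ) (S : Finset (Fin n)) (y : Fin n → ℝ) :
    ∫⁻ τ, likelihood PA Δ f S y (s τ) ∂P ≠ ∞ := by
  refine ne_top_of_le_ne_top (b := ∏ _i ∈ S, ENNReal.ofReal (1 / Real.sqrt (2 * Real.pi * Δ)))
    (ENNReal.prod_ne_top fun _ _ => ENNReal.ofReal_ne_top) ?_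
  refine (lintegral_mono fun τ => Finset.prod_le_prod' fun i _ =>
    ENNReal.ofReal_le_ofReal (Pout_le PA hΔ hf (y i) (s τ i))).trans ?_
  rw [lintegral_const, measure_univ, mul_one]

omit [IsProbabilityMeasure PA] [IsProbabilityMeasure P] in
lemma measurable_signal_right {s : T → Fin n → ℝ} (hs : Measurable s)
    {F : (Fin n → ℝ) → (Fin n → ℝ) → ℝ≥0∞}
    (hF : Measurable fun q : (Fin n → ℝ) × (Fin n → ℝ) => F q.1 q.2) (y : Fin n → ℝ) :
    Measurable fun τ => F y (s τ) :=
  hF.comp (measurable_const.prodMk hs)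

lemma measurable_likelihood_left (hf : Measurable (Function.uncurry f)) {s : T → Fin n → ℝ}
    (hs : Measurable s) (S : Finset (Fin n)) (y : Fin n → ℝ) :
    Measurable fun τ => likelihood PA Δ f S y (s τ) :=
  measurable_signal_right hs (measurable_likelihood PA (Δ := Δ) hf S) y

lemma likelihood_ne_zero (hΔ : 0 < Δ) (hf : Measurable (Function.uncurry f)) (S : Finset (Fin n))
    (y s : Fin n → ℝ) : likelihood PA Δ f S y s ≠ 0 := by
  rw [likelihood, Finset.prod_ne_zero_iff]
  exact fun i _ => (ENNReal.ofReal_pos.2 (Pout_pos PA hΔ hf _ _)).ne'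

lemma lintegral_likelihood_ne_zero (hΔ : 0 < Δ) (hf : Measurable (Function.uncurry f))
    {s : T → Fin n → ℝ} (hs : Measurable s) (S : Finset (Fin n)) (y : Fin n → ℝ) :
    ∫⁻ τ, likelihood PA Δ f S y (s τ) ∂P ≠ 0 := by
  rw [Ne, lintegral_eq_zero_iff (measurable_likelihood_left PA hf hs S y)]
  intro h
  obtain ⟨τ, hτ⟩ := h.exists
  exact likelihood_ne_zero PA hΔ hf S y (s τ) hτ

/-- Posterior law given the responses with indices in `S`. -/
def samplePosterior (Δ : ℝ) (f : ℝ → (Fin p → ℝ) → ℝ) (s : T → Fin n → ℝ) (S : Finset (Fin n))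
    (y : Fin n → ℝ) : Measure T :=
  (∫⁻ τ, likelihood PA Δ f S y (s τ) ∂P)⁻¹ •
    P.withDensity fun τ => likelihood PA Δ f S y (s τ)

omit [IsProbabilityMeasure P] in
lemma lintegral_samplePosterior (hf : Measurable (Function.uncurry f)) {s : T → Fin n → ℝ}
    (hs : Measurable s) (S : Finset (Fin n)) (y : Fin n → ℝ) {g : T → ℝ≥0∞} (hg : Measurable g) :
    ∫⁻ τ, g τ ∂(samplePosterior PA P Δ f s S y) = posteriorMean PA P Δ f s S g y := by
  rw [samplePosterior, lintegral_smul_measure,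
    lintegral_withDensity_eq_lintegral_mul _ (measurable_likelihood_left PA hf hs S y) hg,
    posteriorMean, smul_eq_mul, div_eq_mul_inv, mul_comm]
  rfl

lemma isProbabilityMeasure_samplePosterior (hΔ : 0 < Δ) (hf : Measurable (Function.uncurry f))
    {s : T → Fin n → ℝ} (hs : Measurable s) (S : Finset (Fin n)) (y : Fin n → ℝ) :
    IsProbabilityMeasure (samplePosterior PA P Δ f s S y) := by
  constructor
  have h := lintegral_samplePosterior PA P (Δ := Δ) hf hs S y (g := fun _ => 1) measurable_const
  rw [lintegral_const, one_mul] at h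
  rw [h, posteriorMean]
  simp only [mul_one]
  exact ENNReal.div_self (lintegral_likelihood_ne_zero PA P hΔ hf hs S y)
    (lintegral_likelihood_ne_top PA P hΔ hf s S y)

lemma logPart_insert_sub (hΔ : 0 < Δ) (hf : Measurable (Function.uncurry f))
    {s : T → Fin n → ℝ} (hs : Measurable s) {S : Finset (Fin n)} {i : Fin n} (hi : i ∉ S)
    (y : Fin n → ℝ) :
    logPart PA P Δ f s (insert i S) y - logPart PA P Δ f s S y =
      Real.log (∫ τ, Pout PA Δ f (y i) (s τ i) ∂(samplePosterior PA P Δ f s S y)) := by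
  have hg : Measurable fun τ => Pout PA Δ f (y i) (s τ i) :=
    measurable_Pout_signal PA hf ((measurable_pi_apply i).comp hs) (y i)
  have h0 := lintegral_likelihood_ne_zero PA P hΔ hf hs
  have ht := lintegral_likelihood_ne_top PA P hΔ hf s
  rw [logPart, logPart, ← Real.log_div (ENNReal.toReal_ne_zero.2 ⟨h0 _ y, ht _ y⟩)
    (ENNReal.toReal_ne_zero.2 ⟨h0 _ y, ht _ y⟩), ← ENNReal.toReal_div,
    integral_eq_lintegral_of_nonneg_ae
      (Filter.Eventually.of_forall fun τ => (Pout_pos PA hΔ hf _ _).le) hg.aestronglyMeasurable,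
    lintegral_samplePosterior PA P (Δ := Δ) hf hs S y hg.ennreal_ofReal, posteriorMean]
  simp only [likelihood, Finset.prod_insert hi, mul_comm (ENNReal.ofReal _)]

lemma add_pow_four_le (x y : ℝ) : (x + y) ^ 4 ≤ 8 * (x ^ 4 + y ^ 4) := by
  have h1 : (x + y) ^ 2 ≤ 2 * (x ^ 2 + y ^ 2) := by nlinarith [sq_nonneg (x - y)]
  nlinarith [pow_le_pow_left₀ (sq_nonneg (x + y)) h1 2, sq_nonneg (x ^ 2 - y ^ 2)]

/-- Adding one sample changes the log-partition function by a quantity whose square is controlled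
by the fourth powers of the new response and of the posterior signal. -/
lemma sq_logPart_insert_sub_le (hΔ : 0 < Δ) (hf : Measurable (Function.uncurry f)) {K : ℝ}
    (hK : ∀ x A, |f x A| ≤ K * |x|) {s : T → Fin n → ℝ} (hs : Measurable s) {S : Finset (Fin n)}
    {i : Fin n} (hi : i ∉ S) (y : Fin n → ℝ) :
    ENNReal.ofReal ((logPart PA P Δ f s (insert i S) y - logPart PA P Δ f s S y) ^ 2) ≤
      ENNReal.ofReal (2 * Real.log (Real.sqrt (2 * Real.pi * Δ)) ^ 2) +
        ENNReal.ofReal (4 / Δ ^ 2) * ENNReal.ofReal (y i ^ 4) +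
        ENNReal.ofReal (4 * K ^ 4 / Δ ^ 2) *
          posteriorMean PA P Δ f s S (fun τ => ENNReal.ofReal (s τ i ^ 4)) y := by
  have := isProbabilityMeasure_samplePosterior PA P hΔ hf hs S y
  set π := samplePosterior PA P Δ f s S y with hπ
  set c := Real.sqrt (2 * Real.pi * Δ) with hc
  have hcpos : 0 < c := Real.sqrt_pos.2 (by positivity)
  have hsi : Measurable fun τ => s τ i := (measurable_pi_apply i).comp hs
  have hg : Measurable fun τ => Pout PA Δ f (y i) (s τ i) :=
    measurable_Pout_signal PA hf hsi (y i)
  have h4 : ∀ x : ℝ, 0 ≤ x ^ 4 := fun x => (by decide : Even 4).pow_nonneg x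
  have hjensen := sq_log_integral_le (π := π) (h := fun τ => c * Pout PA Δ f (y i) (s τ i))
    (B := fun τ => (y i ^ 2 + K ^ 2 * s τ i ^ 2) / Δ) (hg.const_mul _) (by fun_prop)
    (fun τ => by positivity)
    (fun τ => by
      have := le_Pout PA hΔ hf hK (y i) (s τ i)
      rwa [div_le_iff₀' hcpos] at this)
    (fun τ => by
      have := Pout_le PA hΔ hf (y i) (s τ i)
      rwa [le_div_iff₀' hcpos] at this)
  have hZpos : 0 < ∫ τ, Pout PA Δ f (y i) (s τ i) ∂π := by
    refine (integral_pos_iff_support_of_nonneg (fun τ => (Pout_pos PA hΔ hf _ _).le) ?_).2 ?_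
    · exact integrable_of_measurable_bounded hg (M := 1 / c) fun τ => by
        rw [abs_of_pos (Pout_pos PA hΔ hf _ _)]; exact Pout_le PA hΔ hf _ _
    · have : Function.support (fun τ => Pout PA Δ f (y i) (s τ i)) = Set.univ :=
        Set.eq_univ_of_forall fun τ => (Pout_pos PA hΔ hf _ _).ne'
      rw [this, measure_univ]
      exact zero_lt_one
  rw [integral_const_mul, Real.log_mul hcpos.ne' hZpos.ne'] at hjensen
  rw [logPart_insert_sub PA P hΔ hf hs hi y, ← lintegral_samplePosterior PA P (Δ := Δ) hf hs S y
    ((hsi.pow_const 4).ennreal_ofReal), ← hπ]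
  set l := Real.log (∫ τ, Pout PA Δ f (y i) (s τ i) ∂π) with hl
  calc ENNReal.ofReal (l ^ 2)
      ≤ ENNReal.ofReal (2 * Real.log c ^ 2) + 2 * ENNReal.ofReal ((Real.log c + l) ^ 2) := by
        rw [← ENNReal.ofReal_ofNat, ← ENNReal.ofReal_mul (by norm_num),
          ← ENNReal.ofReal_add (by positivity) (by positivity)]
        exact ENNReal.ofReal_le_ofReal (by nlinarith [sq_nonneg (2 * Real.log c + l)])
    _ ≤ ENNReal.ofReal (2 * Real.log c ^ 2) +
        2 * ∫⁻ τ, ENNReal.ofReal (((y i ^ 2 + K ^ 2 * s τ i ^ 2) / Δ) ^ 2) ∂π := by gcongr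
    _ ≤ ENNReal.ofReal (2 * Real.log c ^ 2) +
        ∫⁻ τ, (ENNReal.ofReal (4 / Δ ^ 2) * ENNReal.ofReal (y i ^ 4) +
          ENNReal.ofReal (4 * K ^ 4 / Δ ^ 2) * ENNReal.ofReal (s τ i ^ 4)) ∂π := by
        rw [← lintegral_const_mul' _ _ (by simp)]
        refine add_le_add le_rfl (lintegral_mono fun τ => ?_)
        dsimp only
        rw [← ENNReal.ofReal_ofNat, ← ENNReal.ofReal_mul (by norm_num),
          ← ENNReal.ofReal_mul (by positivity), ← ENNReal.ofReal_mul (by positivity),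
          ← ENNReal.ofReal_add (mul_nonneg (by positivity) (h4 _))
            (mul_nonneg (by positivity) (h4 _))]
        refine ENNReal.ofReal_le_ofReal ?_
        have e : 4 / Δ ^ 2 * y i ^ 4 + 4 * K ^ 4 / Δ ^ 2 * s τ i ^ 4 =
            (4 * (y i ^ 4 + K ^ 4 * s τ i ^ 4)) / Δ ^ 2 := by ring
        rw [e, div_pow, ← mul_div_assoc]
        refine div_le_div_of_nonneg_right ?_ (sq_nonneg _)
        nlinarith [sq_nonneg (y i ^ 2 - K ^ 2 * s τ i ^ 2)]
    _ = _ := by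
        rw [lintegral_add_left measurable_const, lintegral_const, measure_univ, mul_one,
          lintegral_const_mul _ (hsi.pow_const 4).ennreal_ofReal, add_assoc]

/-- Bound on the mean square increment of the log-partition function when the new sample has
a signal with fourth moment `m`. -/
def incrementBound (Δ K : ℝ) (m : ℝ≥0∞) : ℝ≥0∞ :=
  ENNReal.ofReal (2 * Real.log (Real.sqrt (2 * Real.pi * Δ)) ^ 2) +
    ENNReal.ofReal (4 / Δ ^ 2) *
      (ENNReal.ofReal (8 * K ^ 4) * m + ENNReal.ofReal (8 * Δ ^ 2) * gaussFourth) +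
    ENNReal.ofReal (4 * K ^ 4 / Δ ^ 2) * m

lemma incrementBound_lt_top (K : ℝ) {m : ℝ≥0∞} (hm : m < ∞) : incrementBound Δ K m < ∞ := by
  have h := gaussFourth_lt_top
  refine ENNReal.add_lt_top.2 ⟨ENNReal.add_lt_top.2 ⟨ENNReal.ofReal_lt_top, ?_⟩,
    ENNReal.mul_lt_top ENNReal.ofReal_lt_top hm⟩
  exact ENNReal.mul_lt_top ENNReal.ofReal_lt_top (ENNReal.add_lt_top.2
    ⟨ENNReal.mul_lt_top ENNReal.ofReal_lt_top hm, ENNReal.mul_lt_top ENNReal.ofReal_lt_top h⟩)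

lemma measurable_responses (hf : Measurable (Function.uncurry f)) (s : Fin n → ℝ) :
    Measurable (responses (n := n) Δ f s) := by
  refine measurable_pi_lambda _ fun i => ?_
  exact (hf.comp (f := fun q : (Fin n → ℝ) × (Fin n → Fin p → ℝ) => (s i, q.2 i))
    (by fun_prop)).add (by fun_prop)

lemma lintegral_responses_pow_four_le (hΔ : 0 < Δ) {K : ℝ}
    (hK : ∀ x A, |f x A| ≤ K * |x|) (s : Fin n → ℝ) (i : Fin n) :
    ∫⁻ q, ENNReal.ofReal (responses Δ f s q i ^ 4) ∂(noiseMeasure PA n) ≤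
      ENNReal.ofReal (8 * K ^ 4) * ENNReal.ofReal (s i ^ 4) +
        ENNReal.ofReal (8 * Δ ^ 2) * gaussFourth := by
  have h4 : ∀ x : ℝ, 0 ≤ x ^ 4 := fun x => (by decide : Even 4).pow_nonneg x
  have hz : MeasurePreserving (fun q : (Fin n → ℝ) × (Fin n → Fin p → ℝ) => q.1 i)
      (noiseMeasure PA n) stdG :=
    (measurePreserving_eval (fun _ : Fin n => stdG) i).comp measurePreserving_fst
  calc ∫⁻ q, ENNReal.ofReal (responses Δ f s q i ^ 4) ∂(noiseMeasure PA n)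
      ≤ ∫⁻ q, (ENNReal.ofReal (8 * K ^ 4) * ENNReal.ofReal (s i ^ 4) +
          ENNReal.ofReal (8 * Δ ^ 2) * ENNReal.ofReal (q.1 i ^ 4)) ∂(noiseMeasure PA n) := by
        refine lintegral_mono fun q => ?_
        rw [← ENNReal.ofReal_mul (by positivity), ← ENNReal.ofReal_mul (by positivity),
          ← ENNReal.ofReal_add (mul_nonneg (by positivity) (h4 _))
            (mul_nonneg (by positivity) (h4 _))]
        refine ENNReal.ofReal_le_ofReal ((add_pow_four_le _ _).trans ?_)
        have h1 : f (s i) (q.2 i) ^ 4 ≤ K ^ 4 * s i ^ 4 := by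
          rw [← (by decide : Even 4).pow_abs, ← (by decide : Even 4).pow_abs (s i), ← mul_pow]
          exact pow_le_pow_left₀ (abs_nonneg _) (hK _ _) 4
        have h2 : (Real.sqrt Δ * q.1 i) ^ 4 ≤ Δ ^ 2 * q.1 i ^ 4 := by
          rw [mul_pow]
          exact mul_le_mul_of_nonneg_right (sqrt_pow_four_le le_rfl hΔ.le) (h4 _)
        linarith
    _ = _ := by
        rw [lintegral_add_left measurable_const, lintegral_const, measure_univ, mul_one,
          lintegral_const_mul _ (by fun_prop),
          hz.lintegral_comp (f := fun z => ENNReal.ofReal (z ^ 4)) (by fun_prop), gaussFourth]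

lemma lintegral_sq_logPart_insert_sub_le (hΔ : 0 < Δ) (hf : Measurable (Function.uncurry f))
    {K : ℝ} (hK : ∀ x A, |f x A| ≤ K * |x|) {s : T → Fin n → ℝ} (hs : Measurable s)
    {S : Finset (Fin n)} {i : Fin n} (hi : i ∉ S) :
    ∫⁻ τ, ∫⁻ q, ENNReal.ofReal ((logPart PA P Δ f s (insert i S) (responses Δ f (s τ) q) -
        logPart PA P Δ f s S (responses Δ f (s τ) q)) ^ 2) ∂(noiseMeasure PA n) ∂P ≤
      incrementBound Δ K (∫⁻ τ, ENNReal.ofReal (s τ i ^ 4) ∂P) := by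
  have hs4 : Measurable fun τ => ENNReal.ofReal (s τ i ^ 4) :=
    (((measurable_pi_apply i).comp hs).pow_const 4).ennreal_ofReal
  have hn := nishimori PA P hΔ hf hs S hs4
  have hpm := measurable_posteriorMean PA P (Δ := Δ) hf hs S hs4
  set pm := posteriorMean PA P Δ f s S (fun τ => ENNReal.ofReal (s τ i ^ 4)) with hpmdef
  set m := ∫⁻ τ, ENNReal.ofReal (s τ i ^ 4) ∂P with hm
  have hresp := fun τ => measurable_responses (p := p) (Δ := Δ) hf (s τ)
  calc _ ≤ ∫⁻ τ, (ENNReal.ofReal (2 * Real.log (Real.sqrt (2 * Real.pi * Δ)) ^ 2) +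
        ENNReal.ofReal (4 / Δ ^ 2) * (ENNReal.ofReal (8 * K ^ 4) * ENNReal.ofReal (s τ i ^ 4) +
          ENNReal.ofReal (8 * Δ ^ 2) * gaussFourth) +
        ENNReal.ofReal (4 * K ^ 4 / Δ ^ 2) *
          ∫⁻ q, pm (responses Δ f (s τ) q) ∂(noiseMeasure PA n)) ∂P := by
        refine lintegral_mono fun τ => ?_
        refine (lintegral_mono fun q => sq_logPart_insert_sub_le PA P hΔ hf hK hs hi _).trans ?_
        have hpr : Measurable fun q => pm (responses Δ f (s τ) q) := hpm.comp (hresp τ)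
        rw [← hpmdef, lintegral_add_right _ (hpr.const_mul _),
          lintegral_add_left measurable_const, lintegral_const, measure_univ, mul_one,
          lintegral_const_mul' _ _ ENNReal.ofReal_ne_top,
          lintegral_const_mul' _ _ ENNReal.ofReal_ne_top]
        gcongr
        exact lintegral_responses_pow_four_le PA hΔ hK (s τ) i
    _ = ENNReal.ofReal (2 * Real.log (Real.sqrt (2 * Real.pi * Δ)) ^ 2) +
        ENNReal.ofReal (4 / Δ ^ 2) * (ENNReal.ofReal (8 * K ^ 4) * m +
          ENNReal.ofReal (8 * Δ ^ 2) * gaussFourth) +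
        ENNReal.ofReal (4 * K ^ 4 / Δ ^ 2) *
          ∫⁻ τ, ∫⁻ q, pm (responses Δ f (s τ) q) ∂(noiseMeasure PA n) ∂P := by
        rw [lintegral_add_left (by fun_prop),
          lintegral_add_left measurable_const, lintegral_const, measure_univ, mul_one,
          lintegral_const_mul' _ _ ENNReal.ofReal_ne_top,
          lintegral_const_mul' _ _ ENNReal.ofReal_ne_top,
          lintegral_add_left (hs4.const_mul _), lintegral_const, measure_univ, mul_one,
          lintegral_const_mul' _ _ ENNReal.ofReal_ne_top]
    _ ≤ _ := by
        rw [incrementBound]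
        gcongr

end Increment

section Rearrangement

/-- The coordinate permutation of `toInterpSpace`, for arbitrary factors. -/
lemma measurePreserving_regroup {X W A V Z Z' N : Type*} [MeasurableSpace X] [MeasurableSpace W]
    [MeasurableSpace A] [MeasurableSpace V] [MeasurableSpace Z] [MeasurableSpace Z']
    [MeasurableSpace N] (mX : Measure X) (mW : Measure W) (ma : Measure A) (mv : Measure V)
    (mz : Measure Z) (mz' : Measure Z') (mN : Measure N) [SFinite mX] [SFinite mW] [SFinite ma]
    [SFinite mv] [SFinite mz] [SFinite mz'] [SFinite mN] :
    MeasurePreserving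
      (fun q : X × (W × A × V × Z) × Z' × N =>
        ((q.1, q.2.1.2.2.2, q.2.2.1), q.2.2.2, q.2.1.1, q.2.1.2.1, q.2.1.2.2.1))
      (mX.prod ((mW.prod (ma.prod (mv.prod mz))).prod (mz'.prod mN)))
      ((mX.prod (mz.prod mz')).prod (mN.prod (mW.prod (ma.prod mv)))) := by
  have h1 : MeasurePreserving (fun τ : W × A × V × Z => ((τ.1, τ.2.1, τ.2.2.1), τ.2.2.2))
      (mW.prod (ma.prod (mv.prod mz))) ((mW.prod (ma.prod mv)).prod mz) :=
    (measurePreserving_prodAssoc mW (ma.prod mv) mz).symm.comp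
      ((MeasurePreserving.id mW).prod (measurePreserving_prodAssoc ma mv mz).symm)
  have h2 : MeasurePreserving
      (fun q : ((W × A × V) × Z) × Z' × N => ((q.1.2, q.2.1), q.2.2, q.1.1))
      (((mW.prod (ma.prod mv)).prod mz).prod (mz'.prod mN))
      ((mz.prod mz').prod (mN.prod (mW.prod (ma.prod mv)))) :=
    (measurePreserving_prodAssoc (mz.prod mz') mN (mW.prod (ma.prod mv))).comp
      (((measurePreserving_prodAssoc mz mz' mN).symm.prod
        (MeasurePreserving.id (mW.prod (ma.prod mv)))).comp
        (Measure.measurePreserving_swap.comp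
          (measurePreserving_prodAssoc (mW.prod (ma.prod mv)) mz (mz'.prod mN))))
  exact (measurePreserving_prodAssoc mX (mz.prod mz') (mN.prod (mW.prod (ma.prod mv)))).symm.comp
    ((MeasurePreserving.id mX).prod (h2.comp (h1.prod (MeasurePreserving.id (mz'.prod mN)))))

variable {d : ℕ → ℕ} {L n p : ℕ}

/-- Reassembles the quenched randomness from the inputs, the teacher variables `(W, a, v, ζ)` and
the noise and channel variables `(Z, A)`. -/
def toInterpSpace (q : (Fin n → Fin (d 0) → ℝ) × studSpace d L n ×
    (Fin n → ℝ) × (Fin n → Fin p → ℝ)) : interpSpace d L p n :=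
  ((q.1, q.2.1.2.2.2, q.2.2.1), q.2.2.2, q.2.1.1, q.2.1.2.1, q.2.1.2.2.1)

lemma measurePreserving_toInterpSpace (PA : Measure (Fin p → ℝ)) [IsProbabilityMeasure PA] :
    MeasurePreserving (toInterpSpace (d := d) (L := L) (n := n) (p := p))
      ((Measure.pi fun _ : Fin n => stdGPi (d 0)).prod
        ((studMeasure d L n).prod (noiseMeasure PA n))) (interpMeasure d L p n PA) :=
  measurePreserving_regroup (Measure.pi fun _ : Fin n => stdGPi (d 0)) (Wmeasure d L)
    (stdGPi (d L)) (stdGPi (d (L - 1))) (stdGPi n) (stdGPi n) (Measure.pi fun _ : Fin n => PA)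

/-- Collects the Gaussian variables attached to each sample. -/
def toPsi1Space (x : Fin n → (Fin (d 0) → ℝ) × ℝ × ℝ) : psi1Space d n :=
  (fun μ => (x μ).1, fun μ => (x μ).2.1, fun μ => (x μ).2.2)

lemma measurePreserving_toPsi1Space :
    MeasurePreserving (toPsi1Space (d := d) (n := n))
      (Measure.pi fun _ => (stdGPi (d 0)).prod (stdG.prod stdG)) (psi1Measure d n) :=
  ((MeasurePreserving.id (Measure.pi fun _ : Fin n => stdGPi (d 0))).prod
    (measurePreserving_arrowProdEquivProdArrow ℝ ℝ (Fin n) (fun _ => stdG) (fun _ => stdG))).comp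
    (measurePreserving_arrowProdEquivProdArrow (Fin (d 0) → ℝ) (ℝ × ℝ) (Fin n)
      (fun _ => stdGPi (d 0)) (fun _ => stdG.prod stdG))

end Rearrangement

/-- A function of independent blocks `x i` and of a parameter, built by adding the blocks one at a
time, has mean conditional variance over the blocks controlled by its squared increments. -/
lemma lintegral_sq_sub_integral_le {X Ω₁ Ω₂ : Type*} [MeasurableSpace X] [MeasurableSpace Ω₁]
    [MeasurableSpace Ω₂] (ν : Measure X) [IsProbabilityMeasure ν] (μ₁ : Measure Ω₁)
    [IsProbabilityMeasure μ₁] (μ₂ : Measure Ω₂) [IsProbabilityMeasure μ₂] {n : ℕ}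
    {e : (Fin n → X) → Ω₁} (he : MeasurePreserving e (Measure.pi fun _ => ν) μ₁)
    {H : Finset (Fin n) → Ω₁ × Ω₂ → ℝ} (hH : ∀ S, Measurable (H S)) (h0 : H ∅ = 0)
    (hupd : ∀ S, ∀ i ∉ S, ∀ x y ω₂, H S (e (Function.update x i y), ω₂) = H S (e x, ω₂))
    {B : ℝ≥0∞} (hB : B < ∞)
    (hinc : ∀ S, ∀ i ∉ S, ∫⁻ ω, ENNReal.ofReal ((H (insert i S) ω - H S ω) ^ 2) ∂(μ₁.prod μ₂) ≤ B) :
    ∫⁻ ω, ENNReal.ofReal ((H Finset.univ ω - ∫ ω₁, H Finset.univ (ω₁, ω.2) ∂μ₁) ^ 2)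
      ∂(μ₁.prod μ₂) ≤ n * B := by
  have hmem : ∀ S, MemLp (H S) 2 (μ₁.prod μ₂) := fun S => by
    induction S using Finset.induction_on with
    | empty => rw [h0]; exact MemLp.zero
    | insert i S hi ih =>
      have hd : MemLp (fun ω => H (insert i S) ω - H S ω) 2 (μ₁.prod μ₂) := by
        have hm := (hH (insert i S)).sub (hH S)
        refine (memLp_two_iff_integrable_sq hm.aestronglyMeasurable).2
          ⟨(hm.pow_const 2).aestronglyMeasurable, ?_⟩
        rw [hasFiniteIntegral_iff_ofReal (Filter.Eventually.of_forall fun x => sq_nonneg _)]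
        exact (hinc S i hi).trans_lt hB
      exact (hd.add ih).ae_eq (Filter.Eventually.of_forall fun ω => by simp)
  have hslice : ∀ᵐ ω₂ ∂μ₂, MemLp (fun ω₁ => H Finset.univ (ω₁, ω₂)) 2 μ₁ := by
    filter_upwards [(hmem Finset.univ).integrable_sq.prod_left_ae] with ω₂ h
    exact (memLp_two_iff_integrable_sq
      ((hH _).comp measurable_prodMk_right).aestronglyMeasurable).2 h
  have hmean : Measurable fun ω₂ => ∫ ω₁, H Finset.univ (ω₁, ω₂) ∂μ₁ :=
    (hH Finset.univ).stronglyMeasurable.integral_prod_left'.measurable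
  have hd : ∀ i, Measurable fun ω : Ω₁ × Ω₂ =>
      ENNReal.ofReal ((H Finset.univ ω - H (Finset.univ.erase i) ω) ^ 2) := fun i =>
    (((hH _).sub (hH _)).pow_const 2).ennreal_ofReal
  have hdev : Measurable fun ω : Ω₁ × Ω₂ =>
      ENNReal.ofReal ((H Finset.univ ω - ∫ ω₁, H Finset.univ (ω₁, ω.2) ∂μ₁) ^ 2) :=
    (((hH _).sub (hmean.comp measurable_snd)).pow_const 2).ennreal_ofReal
  rw [lintegral_prod_symm' _ hdev]
  calc _ ≤ ∫⁻ ω₂, ∑ i, ∫⁻ ω₁, ENNReal.ofReal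
          ((H Finset.univ (ω₁, ω₂) - H (Finset.univ.erase i) (ω₁, ω₂)) ^ 2) ∂μ₁ ∂μ₂ := by
        refine lintegral_mono_ae ?_
        filter_upwards [hslice] with ω₂ h
        have hm : ∀ S, Measurable fun ω₁ => H S (ω₁, ω₂) := fun S =>
          (hH S).comp measurable_prodMk_right
        have hES := efronStein ν (F := fun x => H Finset.univ (e x, ω₂))
          (G := fun i x => H (Finset.univ.erase i) (e x, ω₂)) ((hm _).comp he.measurable)
          (h.comp_measurePreserving he) (fun i => (hm _).comp he.measurable)
          (fun i x y => hupd _ i (Finset.notMem_erase i _) x y ω₂)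
        have hcongr : ∫ x, H Finset.univ (e x, ω₂) ∂(Measure.pi fun _ => ν) =
            ∫ ω₁, H Finset.univ (ω₁, ω₂) ∂μ₁ := by
          rw [← he.map_eq, integral_map he.measurable.aemeasurable (hm _).aestronglyMeasurable]
        rw [hcongr] at hES
        convert hES using 2 with i
        · exact (he.lintegral_comp (((hm _).sub_const _).pow_const 2).ennreal_ofReal).symm
        · exact (he.lintegral_comp (((hm _).sub (hm _)).pow_const 2).ennreal_ofReal).symm
    _ = ∑ i, ∫⁻ ω, ENNReal.ofReal
          ((H Finset.univ ω - H (Finset.univ.erase i) ω) ^ 2) ∂(μ₁.prod μ₂) := by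
        rw [lintegral_finsetSum _ fun i _ => (hd i).lintegral_prod_left']
        exact Finset.sum_congr rfl fun i _ => (lintegral_prod_symm' _ (hd i)).symm
    _ ≤ ∑ _i : Fin n, B := Finset.sum_le_sum fun i _ => by
        have := hinc (Finset.univ.erase i) i (Finset.notMem_erase i _)
        rwa [Finset.insert_erase (Finset.mem_univ i)] at this
    _ = n * B := by simp

/-- Version of `lintegral_sq_sub_integral_le` for the empirical mean `H univ / n`. -/
lemma integral_sq_mean_sub_integral_le {X Ω₁ Ω₂ : Type*} [MeasurableSpace X] [MeasurableSpace Ω₁]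
    [MeasurableSpace Ω₂] (ν : Measure X) [IsProbabilityMeasure ν] (μ₁ : Measure Ω₁)
    [IsProbabilityMeasure μ₁] (μ₂ : Measure Ω₂) [IsProbabilityMeasure μ₂] {n : ℕ} (hn : 1 ≤ n)
    {e : (Fin n → X) → Ω₁} (he : MeasurePreserving e (Measure.pi fun _ => ν) μ₁)
    {H : Finset (Fin n) → Ω₁ × Ω₂ → ℝ} (hH : ∀ S, Measurable (H S)) (h0 : H ∅ = 0)
    (hupd : ∀ S, ∀ i ∉ S, ∀ x y ω₂, H S (e (Function.update x i y), ω₂) = H S (e x, ω₂))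
    {B : ℝ≥0∞} (hB : B < ∞)
    (hinc : ∀ S, ∀ i ∉ S, ∫⁻ ω, ENNReal.ofReal ((H (insert i S) ω - H S ω) ^ 2) ∂(μ₁.prod μ₂) ≤ B) :
    ∫ ω, (1 / (n : ℝ) * H Finset.univ ω - ∫ ω₁, 1 / (n : ℝ) * H Finset.univ (ω₁, ω.2) ∂μ₁) ^ 2
      ∂(μ₁.prod μ₂) ≤ B.toReal / n := by
  have hn0 : (0 : ℝ) < n := by exact_mod_cast hn
  have hmean : Measurable fun ω₂ => ∫ ω₁, H Finset.univ (ω₁, ω₂) ∂μ₁ :=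
    (hH Finset.univ).stronglyMeasurable.integral_prod_left'.measurable
  have hm : Measurable fun ω : Ω₁ × Ω₂ =>
      (H Finset.univ ω - ∫ ω₁, H Finset.univ (ω₁, ω.2) ∂μ₁) ^ 2 :=
    ((hH Finset.univ).sub (hmean.comp measurable_snd)).pow_const 2
  have hvar : ∫ ω, (H Finset.univ ω - ∫ ω₁, H Finset.univ (ω₁, ω.2) ∂μ₁) ^ 2 ∂(μ₁.prod μ₂) ≤
      n * B.toReal := by
    rw [integral_eq_lintegral_of_nonneg_ae (Filter.Eventually.of_forall fun ω => sq_nonneg _)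
      hm.aestronglyMeasurable]
    refine (ENNReal.toReal_mono (ENNReal.mul_ne_top (ENNReal.natCast_ne_top n) hB.ne)
      (lintegral_sq_sub_integral_le ν μ₁ μ₂ he hH h0 hupd hB hinc)).trans_eq (by simp)
  simp_rw [integral_const_mul, ← mul_sub, mul_pow, integral_const_mul]
  calc _ ≤ (1 / (n : ℝ)) ^ 2 * (n * B.toReal) := by gcongr
    _ = B.toReal / n := by field_simp

section Interpolation

lemma lintegral_incrementBound_le {X : Type*} [MeasurableSpace X] (μ : Measure X)
    [IsProbabilityMeasure μ] (Δ K : ℝ) {m : X → ℝ≥0∞} (hm : Measurable m) {M : ℝ≥0∞}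
    (hM : ∫⁻ x, m x ∂μ ≤ M) : ∫⁻ x, incrementBound Δ K (m x) ∂μ ≤ incrementBound Δ K M := by
  unfold incrementBound
  rw [lintegral_add_right _ (by fun_prop), lintegral_add_left measurable_const,
    lintegral_const_mul _ (by fun_prop), lintegral_add_right _ measurable_const,
    lintegral_const_mul _ hm, lintegral_const_mul _ hm]
  simp only [lintegral_const, measure_univ, mul_one]
  gcongr

variable {d : ℕ → ℕ} {L n p : ℕ} (PA : Measure (Fin p → ℝ)) [IsProbabilityMeasure PA] {Δ : ℝ}
  {φ : ℝ → ℝ} {f : ℝ → (Fin p → ℝ) → ℝ}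

omit [IsProbabilityMeasure PA] in
lemma logPart_congr {T : Type*} [MeasurableSpace T] (P : Measure T) {S : Finset (Fin n)}
    {s s' : T → Fin n → ℝ} {y y' : Fin n → ℝ} (hs : ∀ τ, ∀ j ∈ S, s τ j = s' τ j)
    (hy : ∀ j ∈ S, y j = y' j) : logPart PA P Δ f s S y = logPart PA P Δ f s' S y' := by
  have h : ∀ τ, likelihood PA Δ f S y (s τ) = likelihood PA Δ f S y' (s' τ) := fun τ =>
    Finset.prod_congr rfl fun j hj => by rw [hs τ j hj, hy j hj]
  unfold logPart
  simp_rw [h]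

lemma measurable_logPart {Ω T : Type*} [MeasurableSpace Ω] [MeasurableSpace T] (P : Measure T)
    [SFinite P] (hf : Measurable (Function.uncurry f)) {Y : Ω → Fin n → ℝ} (hY : Measurable Y)
    {s : Ω → T → Fin n → ℝ} (hs : Measurable fun q : Ω × T => s q.1 q.2) (S : Finset (Fin n)) :
    Measurable fun ω => logPart PA P Δ f (s ω) S (Y ω) := by
  have hF := measurable_likelihood PA (Δ := Δ) hf S
  unfold logPart
  generalize likelihood PA Δ f S = F at hF ⊢
  have h : Measurable fun q : Ω × T => F (Y q.1) (s q.1 q.2) :=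
    hF.comp ((hY.comp measurable_fst).prodMk hs)
  exact Real.measurable_log.comp h.lintegral_prod_right'.ennreal_toReal

lemma log_integral_prod_Pout {T : Type*} [MeasurableSpace T] (P : Measure T) (hΔ : 0 < Δ)
    (hf : Measurable (Function.uncurry f)) {s : T → Fin n → ℝ} (hs : Measurable s)
    (y : Fin n → ℝ) : Real.log (∫ τ, ∏ i, Pout PA Δ f (y i) (s τ i) ∂P) =
      logPart PA P Δ f s Finset.univ y := by
  have hm : Measurable fun τ => ∏ i, Pout PA Δ f (y i) (s τ i) :=
    Finset.measurable_prod _ fun i _ =>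
      measurable_Pout_signal PA hf ((measurable_pi_apply i).comp hs) _
  have hpos : ∀ y s, 0 < Pout PA Δ f y s := Pout_pos PA hΔ hf
  unfold logPart likelihood
  rw [integral_eq_lintegral_of_nonneg_ae (Filter.Eventually.of_forall fun τ =>
    Finset.prod_nonneg fun i _ => (hpos _ _).le) hm.aestronglyMeasurable]
  simp_rw [ENNReal.ofReal_prod_of_nonneg fun i _ => (hpos _ _).le]

lemma measurable_stI_right (hφ : Measurable φ) (t : ℝ) (X : Fin n → Fin (d 0) → ℝ) :
    Measurable (stI φ d L n t X) := by
  have h := measurable_stI (d := d) (L := L) hφ n t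
  generalize stI φ d L n t = G at h ⊢
  exact h.comp measurable_prodMk_left

/-- Logarithm of the interpolating partition function restricted to the samples in `S`. -/
def interpLogPart (Δ : ℝ) (φ : ℝ → ℝ) (f : ℝ → (Fin p → ℝ) → ℝ) (d : ℕ → ℕ) (L n : ℕ) (t : ℝ)
    (S : Finset (Fin n)) (ω : interpSpace d L p n) : ℝ :=
  logPart PA (studMeasure d L n) Δ f (stI φ d L n t ω.1.1) S (YtI φ f d L n Δ t ω)

omit [IsProbabilityMeasure PA] in
lemma interpLogPart_empty (t : ℝ) : interpLogPart PA Δ φ f d L n t ∅ = 0 := by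
  funext ω
  simp [interpLogPart, logPart, likelihood]

lemma log_ZtI (hΔ : 0 < Δ) (hφ : Measurable φ) (hf : Measurable (Function.uncurry f)) (t : ℝ)
    (ω : interpSpace d L p n) :
    Real.log (ZtI L p PA Δ φ f d n t ω) = interpLogPart PA Δ φ f d L n t Finset.univ ω :=
  log_integral_prod_Pout PA (studMeasure d L n) hΔ hf (measurable_stI_right hφ t ω.1.1)
    (YtI φ f d L n Δ t ω)

omit [IsProbabilityMeasure PA] in
lemma interpLogPart_update (t : ℝ) {S : Finset (Fin n)} {i : Fin n} (hi : i ∉ S)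
    (x : Fin n → (Fin (d 0) → ℝ) × ℝ × ℝ) (y : (Fin (d 0) → ℝ) × ℝ × ℝ)
    (ω₂ : psi2Space p n × psi3Space d L) :
    interpLogPart PA Δ φ f d L n t S (toPsi1Space (Function.update x i y), ω₂) =
      interpLogPart PA Δ φ f d L n t S (toPsi1Space x, ω₂) := by
  have hne : ∀ j ∈ S, Function.update x i y j = x j := fun j hj =>
    Function.update_of_ne (by rintro rfl; exact hi hj) _ _
  refine logPart_congr PA _ (fun τ j hj => ?_) (fun j hj => ?_)
  · simp only [stI, toPsi1Space, hne j hj]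
  · simp only [YtI, StI, toPsi1Space, hne j hj]

lemma measurable_YtI (hφ : Measurable φ) (hf : Measurable (Function.uncurry f)) (t : ℝ) :
    Measurable fun ω : interpSpace d L p n => YtI φ f d L n Δ t ω := by
  have hst := measurable_stI (d := d) (L := L) hφ n t
  have hq : Measurable fun ω : interpSpace d L p n =>
      ((ω.1.1, (ω.2.2.1, ω.2.2.2.1, ω.2.2.2.2, ω.1.2.1)) :
        (Fin n → Fin (d 0) → ℝ) × studSpace d L n) := by fun_prop
  refine measurable_pi_lambda _ fun i => ?_
  have hS : Measurable fun ω : interpSpace d L p n => StI φ d L p n t ω i :=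
    (measurable_pi_apply i).comp (hst.comp hq)
  have hA : Measurable fun ω : interpSpace d L p n => ω.2.1 i := by fun_prop
  have hZ : Measurable fun ω : interpSpace d L p n => Real.sqrt Δ * ω.1.2.2 i := by fun_prop
  exact (hf.comp (hS.prodMk hA)).add hZ

lemma measurable_interpLogPart (hφ : Measurable φ) (hf : Measurable (Function.uncurry f)) (t : ℝ)
    (S : Finset (Fin n)) : Measurable (interpLogPart PA Δ φ f d L n t S) := by
  have hX : Measurable fun q : interpSpace d L p n × studSpace d L n => (q.1.1.1, q.2) := by
    fun_prop
  have hs : Measurable fun q : interpSpace d L p n × studSpace d L n =>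
      stI φ d L n t q.1.1.1 q.2 := by
    have h := measurable_stI (d := d) (L := L) hφ n t
    generalize stI φ d L n t = G at h ⊢
    exact h.comp hX
  exact measurable_logPart PA (studMeasure d L n) hf (measurable_YtI hφ hf t) hs S

lemma lintegral_sq_interpLogPart_insert_sub_le (hΔ : 0 < Δ) (hφ : Measurable φ) {Kφ : ℝ}
    (hKφ : ∀ x, |φ x| ≤ Kφ * |x|) (hf : Measurable (Function.uncurry f)) {Kf : ℝ}
    (hKf : ∀ x A, |f x A| ≤ Kf * |x|) {t : ℝ} (ht0 : 0 ≤ t) (ht1 : t ≤ 1) {S : Finset (Fin n)}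
    {i : Fin n} (hi : i ∉ S) :
    ∫⁻ ω, ENNReal.ofReal ((interpLogPart PA Δ φ f d L n t (insert i S) ω -
        interpLogPart PA Δ φ f d L n t S ω) ^ 2) ∂(interpMeasure d L p n PA) ≤
      incrementBound Δ Kf (signalFourBound φ L Kφ) := by
  have hst := measurable_stI (d := d) (L := L) hφ n t
  have hmS := measurable_interpLogPart PA (d := d) (L := L) (n := n) (Δ := Δ) hφ hf t
  have hm : Measurable fun ω : interpSpace d L p n =>
      ENNReal.ofReal ((interpLogPart PA Δ φ f d L n t (insert i S) ω -
        interpLogPart PA Δ φ f d L n t S ω) ^ 2) :=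
    (((hmS _).sub (hmS S)).pow_const 2).ennreal_ofReal
  have hs4 : Measurable fun X : Fin n → Fin (d 0) → ℝ =>
      ∫⁻ τ, ENNReal.ofReal (stI φ d L n t X τ i ^ 4) ∂(studMeasure d L n) :=
    ((((measurable_pi_apply i).comp hst).pow_const 4).ennreal_ofReal).lintegral_prod_right'
  have hT := measurePreserving_toInterpSpace (d := d) (L := L) (n := n) PA
  refine le_trans ?_ (lintegral_incrementBound_le _ Δ Kf hs4
    (lintegral_stI_pow_four_le hφ hKφ ht0 ht1 i))
  rw [← hT.lintegral_comp hm]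
  refine (lintegral_prod _ (hm.comp hT.measurable).aemeasurable).trans_le ?_
  refine lintegral_mono fun X => ?_
  refine le_trans (le_of_eq ?_)
    (lintegral_sq_logPart_insert_sub_le PA (studMeasure d L n) hΔ hf hKf
      (measurable_stI_right hφ t X) hi)
  exact lintegral_prod _ ((hm.comp hT.measurable).comp measurable_prodMk_left).aemeasurable

end Interpolation

/-- **Lemma G.3 (Free entropy concentration w.r.t. the Gaussian disorder `ψ₁`).**
Uniformly in `t ∈ [0,1]`,
`E((1/n) log Z_t − E_{ψ₁}(1/n) log Z_t)² ≤ C(f,φ)/n`. -/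
theorem free_entropy_concentration_psi1
    (L p : ℕ) (hL : 1 ≤ L)
    (PA : Measure (Fin p → ℝ)) [IsProbabilityMeasure PA]
    (Δ : ℝ) (hΔ : 0 < Δ)
    (φ : ℝ → ℝ) (f : ℝ → (Fin p → ℝ) → ℝ)
    (hφC2 : ContDiff ℝ 2 φ) (hφodd : ∀ x, φ (-x) = -φ x)
    (hφbd : ∃ K, ∀ x, |deriv φ x| ≤ K ∧ |deriv (deriv φ) x| ≤ K)
    (hfC2 : ∀ A, ContDiff ℝ 2 (fun x => f x A))
    (hfodd : ∀ x A, f (-x) A = -f x A)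
    (hfbd : ∃ K, ∀ x A, |deriv (fun x' => f x' A) x| ≤ K ∧
      |deriv (deriv (fun x' => f x' A)) x| ≤ K)
    (hfmeas : Measurable (Function.uncurry f))
    (R : ℝ) (hR : 1 ≤ R) :
    ∃ C > 0, ∀ n : ℕ, 1 ≤ n → ∀ d : ℕ → ℕ, (∀ ℓ ≤ L, 1 ≤ d ℓ) →
      (∀ ℓ ≤ L, ∀ ℓ' ≤ L, (d ℓ : ℝ) ≤ R * (d ℓ' : ℝ)) →
      ∀ t : ℝ, 0 ≤ t → t ≤ 1 →
      ∫ ω, ((1 / (n : ℝ)) * Real.log (ZtI L p PA Δ φ f d n t ω) -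
            ∫ ω₁', (1 / (n : ℝ)) * Real.log (ZtI L p PA Δ φ f d n t (ω₁', ω.2))
              ∂(psi1Measure d n)) ^ 2
        ∂(interpMeasure d L p n PA) ≤ C / (n : ℝ) := by
  obtain ⟨Kφ, hKφ⟩ := hφbd
  obtain ⟨Kf, hKf⟩ := hfbd
  have hφ : Measurable φ := hφC2.continuous.measurable
  have hφlin := abs_le_mul_abs_of_odd (hφC2.differentiable (by norm_num)) hφodd
    fun x => (hKφ x).1
  have hflin : ∀ x A, |f x A| ≤ Kf * |x| := fun x A =>
    abs_le_mul_abs_of_odd ((hfC2 A).differentiable (by norm_num)) (fun x => hfodd x A)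
      (fun x => (hKf x A).1) x
  set B := incrementBound Δ Kf (signalFourBound φ L Kφ) with hBdef
  have hB : B < ∞ := incrementBound_lt_top Kf (signalFourBound_lt_top Kφ)
  refine ⟨B.toReal + 1, by positivity, fun n hn d _ _ t ht0 ht1 => ?_⟩
  simp_rw [log_ZtI PA hΔ hφ hfmeas]
  calc _ ≤ B.toReal / n :=
        integral_sq_mean_sub_integral_le ((stdGPi (d 0)).prod (stdG.prod stdG)) (psi1Measure d n)
          ((psi2Measure p n PA).prod (psi3Measure d L)) hn measurePreserving_toPsi1Space
          (measurable_interpLogPart PA hφ hfmeas t) (interpLogPart_empty PA t)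
          (fun S i hi => interpLogPart_update PA t hi) hB
          (fun S i hi => lintegral_sq_interpLogPart_insert_sub_le PA hΔ hφ hφlin hfmeas hflin
            ht0 ht1 hi)
    _ ≤ (B.toReal + 1) / n := by gcongr; linarith

end
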